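/- arXiv:1112.4008 — 5 statements merged into one kernel-verified Lean document; each statement's English description precedes it below -/
import Mathlib

section
/- Let k be a finite field of order q, let τ be a field automorphism of k, and let V be a k-vector space of dimension g. For nonnegative integers r, s with s ≤ r ≤ g, the number of τ-semilinear endomorphisms F of V with rk(F) = r and rk_∞(F) = s equals (q^{g²} / q^{(g-r)² + r - s}) · (∏_{j=1}^{g} (1 - q^{-j}) · ∏_{j=g-r}^{g-s-1} (1 - q^{-j})) / (∏_{j=1}^{r-s} (1 - q^{-j}) · ∏_{j=1}^{g-r} (1 - q^{-j})), where an empty product equals 1. -/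
open Module Function

theorem Function.range_iterate_iInter_eq_periodicPts {α : Type*} [Finite α] (f : α → α) :
    ⋂ n : ℕ, Set.range f^[n] = periodicPts f := by
  ext x
  simp only [Set.mem_iInter, Set.mem_range]
  constructor
  · intro h
    obtain ⟨z, rfl⟩ := h (Nat.card α)
    obtain ⟨i, j, hij, he⟩ : ∃ i j : Fin (Nat.card α + 1), i < j ∧ f^[i] z = f^[j] z := by
      have := Fintype.ofFinite α
      obtain ⟨i, j, hij, he⟩ := Fintype.exists_ne_map_eq_of_card_lt
        (fun i : Fin (Nat.card α + 1) => f^[i] z) (by simp)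
      rcases lt_or_gt_of_ne hij with h | h
      exacts [⟨i, j, h, he⟩, ⟨j, i, h, he.symm⟩]
    have hlt : (i : ℕ) < j := hij
    have hp : IsPeriodicPt f (j - i) (f^[i] z) := by
      rw [IsPeriodicPt, IsFixedPt, ← iterate_add_apply, Nat.sub_add_cancel hlt.le, he]
    refine ⟨j - i, Nat.sub_pos_of_lt hlt, ?_⟩
    have hc := hp.apply_iterate (Nat.card α - i)
    rwa [← iterate_add_apply, Nat.sub_add_cancel (Nat.lt_succ_iff.1 i.2)] at hc
  · rintro ⟨n, hn, hx⟩ m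
    refine ⟨f^[n * m - m] x, ?_⟩
    rw [← iterate_add_apply, Nat.add_sub_cancel' (Nat.le_mul_of_pos_left m hn)]
    exact hx.mul_const m

theorem Function.card_periodicPts_comp_le {α β : Type*} [Finite β] (f : α → β) (h : β → α) :
    Nat.card (periodicPts (h ∘ f)) ≤ Nat.card (periodicPts (f ∘ h)) := by
  have hs : Semiconj f (h ∘ f) (f ∘ h) := fun _ => rfl
  refine Nat.card_le_card_of_injective (hs.mapsTo_periodicPts.restrict f _ _) ?_
  refine (Set.MapsTo.restrict_inj _).2 ?_
  exact ((bijOn_periodicPts (h ∘ f)).injOn).of_comp (g := h)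

theorem Function.card_periodicPts_comp_comm {α β : Type*} [Finite α] [Finite β]
    (f : α → β) (h : β → α) :
    Nat.card (periodicPts (h ∘ f)) = Nat.card (periodicPts (f ∘ h)) :=
  le_antisymm (card_periodicPts_comp_le f h) (card_periodicPts_comp_le h f)

theorem Submodule.finrank_inf_ker_add_one {k V : Type*} [Field k] [AddCommGroup V] [Module k V]
    [FiniteDimensional k V] (p : Submodule k V) (μ : Dual k V) (h : ¬ p ≤ LinearMap.ker μ) :
    finrank k (p ⊓ LinearMap.ker μ : Submodule k V) + 1 = finrank k p := by
  have hμ : μ.domRestrict p ≠ 0 := by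
    contrapose! h
    intro x hx
    exact LinearMap.congr_fun h ⟨x, hx⟩
  rw [← Module.Dual.finrank_ker_add_one_of_ne_zero hμ, ← Submodule.map_comap_subtype,
    Submodule.finrank_map_subtype_eq]
  rfl

theorem Subspace.card_dualAnnihilator {k V : Type*} [Field k] [Finite k] [AddCommGroup V]
    [Module k V] [FiniteDimensional k V] (p : Submodule k V) :
    Nat.card {μ : Dual k V // p ≤ LinearMap.ker μ} = Nat.card k ^ (finrank k V - finrank k p) := by
  have h := Subspace.finrank_add_finrank_dualAnnihilator_eq p
  rw [← h, Nat.add_sub_cancel_left]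
  refine Eq.trans ?_ (Module.natCard_eq_pow_finrank (K := k) (V := p.dualAnnihilator))
  refine Nat.card_congr (Equiv.subtypeEquivRight fun μ => ?_)
  rw [Submodule.mem_dualAnnihilator]
  rfl

theorem Submodule.exists_prod_equiv_of_ne_zero {k V : Type*} [Field k] [AddCommGroup V]
    [Module k V] (v : V) (hv : v ≠ 0) :
    ∃ (U : Submodule k V) (e : V ≃ₗ[k] U × k), e v = (0, 1) := by
  obtain ⟨U, hU⟩ := Submodule.exists_isCompl (k ∙ v)
  let e := (Submodule.prodEquivOfIsCompl _ _ hU.symm).symm ≪≫ₗ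
    ((LinearEquiv.refl k U).prodCongr (LinearEquiv.toSpanNonzeroSingleton k V v hv).symm)
  refine ⟨U, e, ?_⟩
  rw [← LinearEquiv.eq_symm_apply]
  simp [e]

/-- The number of `τ`-semilinear endomorphisms of `V` whose kernel has dimension `d` and which have
exactly `(#k) ^ s` periodic points. -/
noncomputable def semilinearCount {k : Type*} (V : Type*) [Field k] [AddCommGroup V] [Module k V]
    (τ : k ≃+* k) (d s : ℕ) : ℕ :=
  Nat.card {F : V →ₛₗ[(τ : k →+* k)] V //
    finrank k (LinearMap.ker F) = d ∧ Nat.card (periodicPts F) = Nat.card k ^ s}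

section

variable {k U V : Type*} [Field k] [AddCommGroup U] [Module k U] [AddCommGroup V] [Module k V]
  (τ : k ≃+* k)

instance [Finite U] [Finite V] : Finite (U →ₛₗ[(τ : k →+* k)] V) :=
  Finite.of_injective (fun F => (F : U → V)) DFunLike.coe_injective

/-- Lift a semilinear endomorphism of `U` and a functional on `U` to a semilinear map to `V`. -/
def semilinearLift (e : V ≃ₗ[k] U × k) (G : U →ₛₗ[(τ : k →+* k)] U) (μ : Dual k U) :
    U →ₛₗ[(τ : k →+* k)] V where
  toFun u := e.symm (G u, τ (μ u))
  map_add' x y := by simp [← map_add]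
  map_smul' a x := by simp [← map_smul]

/-- Semilinear endomorphisms killing a line, in terms of the quotient. -/
def semilinearKillEquiv (e : V ≃ₗ[k] U × k) (v : V) (hv : e v = (0, 1)) :
    (U →ₛₗ[(τ : k →+* k)] U) × Dual k U ≃ {F : V →ₛₗ[(τ : k →+* k)] V // F v = 0} where
  toFun p := ⟨(semilinearLift τ e p.1 p.2).comp ((LinearMap.fst k U k).comp e.toLinearMap), by
    simp [hv]⟩
  invFun F :=
    ⟨((LinearMap.fst k U k).comp e.toLinearMap).comp
      (F.1.comp (e.symm.toLinearMap.comp (LinearMap.inl k U k))),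
     { toFun := fun u => τ.symm (e (F.1 (e.symm (u, 0)))).2
       map_add' := fun x y => by
        have : e.symm (x + y, 0) = e.symm (x, 0) + e.symm (y, 0) := by
          simp [← map_add]
        simp [this]
       map_smul' := fun a x => by
        have : e.symm (a • x, 0) = a • e.symm (x, 0) := by
          simp [← map_smul]
        simp [this] }⟩
  left_inv p := by
    ext u <;> simp [semilinearLift]
  right_inv F := by
    obtain ⟨F, hF⟩ := F
    ext w
    have hw : F (e.symm (0, (e w).2)) = 0 := by
      have : e.symm (0, (e w).2) = (e w).2 • v := by
        rw [LinearEquiv.symm_apply_eq, map_smul, hv]; simp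
      rw [this, F.map_smulₛₗ, hF, smul_zero]
    have h2 : F w = F (e.symm ((e w).1, 0)) := by
      conv_lhs => rw [← e.symm_apply_apply w]
      have : e w = ((e w).1, 0) + (0, (e w).2) := by simp
      rw [this, map_add, map_add, hw, add_zero]
      simp
    simp [semilinearLift, h2]

end

section

variable {k U V : Type*} [Field k] [AddCommGroup U] [Module k U] [AddCommGroup V] [Module k V]
  (τ : k ≃+* k)

theorem finrank_ker_semilinearKillEquiv [FiniteDimensional k U] (e : V ≃ₗ[k] U × k) (v : V) (hv : e v = (0, 1))
    (G : U →ₛₗ[(τ : k →+* k)] U) (μ : Dual k U) :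
    finrank k (LinearMap.ker (semilinearKillEquiv τ e v hv (G, μ)).1) =
      finrank k (LinearMap.ker G ⊓ LinearMap.ker μ : Submodule k U) + 1 := by
  have h : (LinearMap.ker (semilinearKillEquiv τ e v hv (G, μ)).1) =
      ((LinearMap.ker G ⊓ LinearMap.ker μ).prod (⊤ : Submodule k k)).map
        (e.symm : U × k →ₗ[k] V) := by
    ext w
    rw [Submodule.mem_map_equiv]
    simp [semilinearKillEquiv, semilinearLift]
  let e' : (LinearMap.ker G ⊓ LinearMap.ker μ).prod (⊤ : Submodule k k) ≃ₗ[k]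
      (LinearMap.ker G ⊓ LinearMap.ker μ : Submodule k U) × k :=
    { toFun := fun x => (⟨x.1.1, x.2.1⟩, x.1.2)
      invFun := fun x => ⟨(x.1, x.2), x.1.2, trivial⟩
      map_add' := fun _ _ => rfl
      map_smul' := fun _ _ => rfl
      left_inv := fun _ => rfl
      right_inv := fun _ => rfl }
  rw [h, LinearEquiv.finrank_map_eq, e'.finrank_eq, Module.finrank_prod, Module.finrank_self]

theorem card_periodicPts_semilinearKillEquiv [Finite U] [Finite V] (e : V ≃ₗ[k] U × k) (v : V)
    (hv : e v = (0, 1)) (G : U →ₛₗ[(τ : k →+* k)] U) (μ : Dual k U) :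
    Nat.card (periodicPts (semilinearKillEquiv τ e v hv (G, μ)).1) =
      Nat.card (periodicPts G) := by
  have h := card_periodicPts_comp_comm (fun w => (e w).1) (semilinearLift τ e G μ)
  have h2 : (fun w => (e w).1) ∘ (semilinearLift τ e G μ) = G := by
    ext u; simp [semilinearLift]
  rw [h2] at h
  exact h

theorem card_dual_finrank_ker_inf_eq [Finite k] [FiniteDimensional k U] (p : Submodule k U) (d : ℕ) :
    Nat.card {μ : Dual k U // finrank k (p ⊓ LinearMap.ker μ : Submodule k U) = d} =
      (if finrank k p = d then Nat.card k ^ (finrank k U - d) else 0) +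
      (if finrank k p = d + 1 then
        Nat.card k ^ finrank k U - Nat.card k ^ (finrank k U - (d + 1)) else 0) := by
  classical
  have : Finite (Dual k U) := Module.finite_of_finite k
  have key (μ : Dual k U) : (p ≤ LinearMap.ker μ ∧
      finrank k (p ⊓ LinearMap.ker μ : Submodule k U) = finrank k p) ∨ (¬ p ≤ LinearMap.ker μ ∧
      finrank k (p ⊓ LinearMap.ker μ : Submodule k U) + 1 = finrank k p) := by
    by_cases h : p ≤ LinearMap.ker μ
    · exact Or.inl ⟨h, by rw [inf_eq_left.2 h]⟩
    · exact Or.inr ⟨h, p.finrank_inf_ker_add_one μ h⟩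
  split_ifs with h1 h2 h2
  · omega
  · rw [add_zero, ← h1, ← Subspace.card_dualAnnihilator]
    refine Nat.card_congr (Equiv.subtypeEquivRight fun μ => ?_)
    have := key μ
    grind
  · rw [zero_add, ← h2, ← Subspace.card_dualAnnihilator, ← Subspace.dual_finrank_eq,
      ← Module.natCard_eq_pow_finrank (K := k)]
    rw [eq_tsub_iff_add_eq_of_le (Finite.card_subtype_le _), add_comm,
      ← Nat.card_congr (Equiv.sumCompl fun μ : Dual k U => p ≤ LinearMap.ker μ), Nat.card_sum]
    congr 1
    refine Nat.card_congr (Equiv.subtypeEquivRight fun μ => ?_)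
    have := key μ
    grind
  · rw [add_zero, Nat.card_eq_zero]
    left
    refine ⟨fun ⟨μ, hμ⟩ => ?_⟩
    have := key μ
    grind

theorem card_semilinear_apply_eq_zero [Finite k] [FiniteDimensional k U] (e : V ≃ₗ[k] U × k) (v : V)
    (hv : e v = (0, 1)) (d s : ℕ) :
    Nat.card {F : V →ₛₗ[(τ : k →+* k)] V // F v = 0 ∧
      finrank k (LinearMap.ker F) = d + 1 ∧ Nat.card (periodicPts F) = Nat.card k ^ s} =
    semilinearCount U τ d s * Nat.card k ^ (finrank k U - d) +
    semilinearCount U τ (d + 1) s *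
      (Nat.card k ^ finrank k U - Nat.card k ^ (finrank k U - (d + 1))) := by
  classical
  have : Finite U := Module.finite_of_finite k
  have : FiniteDimensional k V := Module.Finite.equiv e.symm
  have : Finite V := Module.finite_of_finite k
  have : Finite (Dual k U) := Module.finite_of_finite k
  have : Fintype (U →ₛₗ[(τ : k →+* k)] U) := Fintype.ofFinite _
  let e1 : {F : V →ₛₗ[(τ : k →+* k)] V // F v = 0 ∧
      finrank k (LinearMap.ker F) = d + 1 ∧ Nat.card (periodicPts F) = Nat.card k ^ s} ≃
      Σ G : U →ₛₗ[(τ : k →+* k)] U, {μ : Dual k U //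
        finrank k (LinearMap.ker G ⊓ LinearMap.ker μ : Submodule k U) = d ∧
        Nat.card (periodicPts G) = Nat.card k ^ s} := by
    refine (Equiv.subtypeSubtypeEquivSubtypeInter _ _).symm.trans ?_
    refine ((semilinearKillEquiv τ e v hv).subtypeEquiv (p := fun p =>
      finrank k (LinearMap.ker p.1 ⊓ LinearMap.ker p.2 : Submodule k U) = d ∧
        Nat.card (periodicPts p.1) = Nat.card k ^ s) fun p => ?_).symm.trans ?_
    · obtain ⟨G, μ⟩ := p
      rw [finrank_ker_semilinearKillEquiv, card_periodicPts_semilinearKillEquiv,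
        Nat.add_right_cancel_iff]
    · exact
      { toFun := fun p => ⟨p.1.1, p.1.2, p.2⟩
        invFun := fun p => ⟨(p.1, p.2.1), p.2.2⟩
        left_inv := fun _ => rfl
        right_inv := fun _ => rfl }
  rw [Nat.card_congr e1, Nat.card_sigma]
  have h (G : U →ₛₗ[(τ : k →+* k)] U) : Nat.card {μ : Dual k U //
        finrank k (LinearMap.ker G ⊓ LinearMap.ker μ : Submodule k U) = d ∧
        Nat.card (periodicPts G) = Nat.card k ^ s} =
      (if finrank k (LinearMap.ker G) = d ∧ Nat.card (periodicPts G) = Nat.card k ^ s then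
        Nat.card k ^ (finrank k U - d) else 0) +
      (if finrank k (LinearMap.ker G) = d + 1 ∧ Nat.card (periodicPts G) = Nat.card k ^ s then
        Nat.card k ^ finrank k U - Nat.card k ^ (finrank k U - (d + 1)) else 0) := by
    by_cases hG : Nat.card (periodicPts G) = Nat.card k ^ s
    · simp only [hG, and_true]
      exact card_dual_finrank_ker_inf_eq _ _
    · simp only [hG, and_false, if_false]
      simp
  simp only [h, Finset.sum_add_distrib, ← Finset.sum_filter, Finset.sum_const, smul_eq_mul,
    semilinearCount, Nat.card_eq_fintype_card, Fintype.card_subtype]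

theorem semilinearCount_mul [Finite k] [FiniteDimensional k V] (d s n : ℕ)
    (hn : finrank k V = n + 1) (B : ℕ → ℕ)
    (hB : ∀ U : Submodule k V, finrank k U = n → ∀ d, semilinearCount U τ d s = B d) :
    semilinearCount V τ (d + 1) s * (Nat.card k ^ (d + 1) - 1) =
      (Nat.card k ^ (n + 1) - 1) * (B d * Nat.card k ^ (n - d) +
        B (d + 1) * (Nat.card k ^ n - Nat.card k ^ (n - (d + 1)))) := by
  classical
  have : Finite V := Module.finite_of_finite k
  have : Fintype V := Fintype.ofFinite _
  have : Fintype (V →ₛₗ[(τ : k →+* k)] V) := Fintype.ofFinite _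
  let S : Finset (V →ₛₗ[(τ : k →+* k)] V) := {F | finrank k (LinearMap.ker F) = d + 1 ∧
    Nat.card (periodicPts F) = Nat.card k ^ s}
  let T : Finset V := {v | v ≠ 0}
  have hS : S.card = semilinearCount V τ (d + 1) s := by
    rw [semilinearCount, Nat.card_eq_fintype_card, Fintype.card_subtype]
  have hT : T.card = Nat.card k ^ (n + 1) - 1 := by
    rw [← hn, ← Module.natCard_eq_pow_finrank (K := k) (V := V), Nat.card_eq_fintype_card]
    simp [T, Finset.filter_ne']
  have h := Finset.sum_card_bipartiteAbove_eq_sum_card_bipartiteBelow (s := S) (t := T)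
    (fun F v => F v = 0)
  rw [Finset.sum_const_nat (m := Nat.card k ^ (d + 1) - 1),
    Finset.sum_const_nat (m := B d * Nat.card k ^ (n - d) +
        B (d + 1) * (Nat.card k ^ n - Nat.card k ^ (n - (d + 1)))), hS, hT] at h
  · exact h
  · intro v hv
    obtain ⟨U, e, he⟩ := Submodule.exists_prod_equiv_of_ne_zero v (k := k) (by simpa [T] using hv)
    have hU : finrank k U = n := by
      have := e.finrank_eq
      rw [Module.finrank_prod, hn, Module.finrank_self] at this
      omega
    rw [← hB U hU, ← hB U hU, ← hU, ← card_semilinear_apply_eq_zero τ e v he,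
      Nat.card_eq_fintype_card, Fintype.card_subtype]
    congr 1
    ext F
    simp [S, Finset.bipartiteBelow, and_comm]
  · intro F hF
    have hF' : finrank k (LinearMap.ker F) = d + 1 := by
      simp only [S, Finset.mem_filter] at hF; exact hF.2.1
    rw [← hF', ← Module.natCard_eq_pow_finrank (K := k) (V := LinearMap.ker F),
      Nat.card_eq_fintype_card, Fintype.card_subtype]
    rw [← Finset.card_erase_of_mem (a := 0) (by simp)]
    congr 1
    ext v
    simp [T, Finset.bipartiteAbove]

end

theorem card_linearMap_ker_eq_bot {k V : Type*} [Field k] [Fintype k] [AddCommGroup V] [Module k V]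
    [FiniteDimensional k V] :
    Nat.card {A : V →ₗ[k] V // LinearMap.ker A = ⊥} =
      ∏ i : Fin (finrank k V), (Fintype.card k ^ finrank k V - Fintype.card k ^ (i : ℕ)) := by
  classical
  rw [← Matrix.card_GL_field]
  let b := Module.finBasis k V
  refine Nat.card_congr (Equiv.trans ?_
    (Units.mapEquiv (LinearMap.toMatrixAlgEquiv b).toMulEquiv).toEquiv)
  exact (Equiv.subtypeEquivRight fun A => (LinearMap.isUnit_iff_ker_eq_bot A).symm).trans
    (Equiv.ofBijective (fun u : (V →ₗ[k] V)ˣ => (⟨u.1, u.isUnit⟩ : {A : V →ₗ[k] V // IsUnit A}))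
      ⟨fun _ _ h => Units.ext (congrArg Subtype.val h), fun ⟨_, u, hu⟩ => ⟨u, Subtype.ext hu⟩⟩).symm

theorem exists_semilinear_bijective {k V : Type*} [Field k] [AddCommGroup V] [Module k V]
    [FiniteDimensional k V] (τ : k ≃+* k) :
    ∃ T : V ≃+ V, ∀ (a : k) (v : V), T (a • v) = τ a • T v := by
  let b := Module.finBasis k V
  let T0 : (Fin (finrank k V) → k) ≃+ (Fin (finrank k V) → k) :=
    AddEquiv.piCongrRight fun _ => τ.toAddEquiv
  refine ⟨(b.equivFun.toAddEquiv.trans T0).trans b.equivFun.symm.toAddEquiv, fun a v => ?_⟩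
  have : T0 (a • b.equivFun v) = τ a • T0 (b.equivFun v) := by
    ext i; simp [T0]
  change b.equivFun.symm (T0 (b.equivFun (a • v))) = τ a • b.equivFun.symm (T0 (b.equivFun v))
  rw [map_smul, this, map_smul]

theorem card_semilinear_ker_eq_bot {k V : Type*} [Field k] [Fintype k] [AddCommGroup V]
    [Module k V] [FiniteDimensional k V] (τ : k ≃+* k) :
    Nat.card {F : V →ₛₗ[(τ : k →+* k)] V // LinearMap.ker F = ⊥} =
      ∏ i : Fin (finrank k V), (Fintype.card k ^ finrank k V - Fintype.card k ^ (i : ℕ)) := by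
  rw [← card_linearMap_ker_eq_bot]
  obtain ⟨T, hT⟩ := exists_semilinear_bijective (V := V) τ
  have hT' (a : k) (v : V) : T.symm (τ a • v) = a • T.symm v := by
    rw [AddEquiv.symm_apply_eq, hT, T.apply_symm_apply]
  let e : (V →ₛₗ[(τ : k →+* k)] V) ≃ (V →ₗ[k] V) :=
    { toFun := fun F =>
        { toFun := fun v => T.symm (F v)
          map_add' := by simp
          map_smul' := fun a v => by
            rw [F.map_smulₛₗ]; exact hT' a _ }
      invFun := fun A =>
        { toFun := fun v => T (A v)
          map_add' := by simp
          map_smul' := fun a v => by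
            rw [A.map_smul, hT]; rfl }
      left_inv := fun F => by ext; simp
      right_inv := fun A => by ext; simp }
  refine Nat.card_congr (e.subtypeEquiv fun F => ?_)
  simp only [LinearMap.ker_eq_bot]
  exact (T.symm.injective.of_comp_iff F).symm

theorem semilinearCount_zero {k V : Type*} [Field k] [Fintype k] [AddCommGroup V] [Module k V]
    [FiniteDimensional k V] (τ : k ≃+* k) (s : ℕ) :
    semilinearCount V τ 0 s = if s = finrank k V then
      ∏ i : Fin (finrank k V), (Fintype.card k ^ finrank k V - Fintype.card k ^ (i : ℕ)) else 0 := by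
  have : Finite V := Module.finite_of_finite k
  have key (F : V →ₛₗ[(τ : k →+* k)] V) : (finrank k (LinearMap.ker F) = 0 ∧
      Nat.card (periodicPts F) = Nat.card k ^ s) ↔ LinearMap.ker F = ⊥ ∧ s = finrank k V := by
    rw [Submodule.finrank_eq_zero]
    refine and_congr_right fun h => ?_
    rw [injective_iff_periodicPts_eq_univ.1 (LinearMap.ker_eq_bot.1 h), Nat.card_univ,
      Module.natCard_eq_pow_finrank (K := k), Nat.pow_right_inj (Finite.one_lt_card), eq_comm]
  simp only [semilinearCount, key]
  split_ifs with h
  · simp only [h, and_true]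
    exact card_semilinear_ker_eq_bot τ
  · simp [h]

/-- The closed formula for the number of semilinear endomorphisms of a space of dimension
`d + e + s` with kernel of dimension `d` and infinity rank `s`. -/
def semilinearFormula (q : ℚ) (d e s : ℕ) : ℚ :=
  q ^ ((d + e + s) ^ 2) / q ^ (d ^ 2 + e) *
    ((∏ j ∈ Finset.range (d + e + s), (1 - q⁻¹ ^ (j + 1))) *
      ∏ j ∈ Finset.range e, (1 - q⁻¹ ^ (d + j))) /
    ((∏ j ∈ Finset.range e, (1 - q⁻¹ ^ (j + 1))) * ∏ j ∈ Finset.range d, (1 - q⁻¹ ^ (j + 1)))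

theorem semilinearFormula_zero_succ (q : ℚ) (e s : ℕ) : semilinearFormula q 0 (e + 1) s = 0 := by
  simp [semilinearFormula, Finset.prod_range_succ']

theorem semilinearFormula_zero_zero (q : ℕ) (hq : 1 < q) (s : ℕ) :
    semilinearFormula q 0 0 s = ((∏ i : Fin s, (q ^ s - q ^ (i : ℕ)) : ℕ) : ℚ) := by
  have hq0 : (q : ℚ) ≠ 0 := by positivity
  rw [Fin.prod_univ_eq_prod_range (fun i => q ^ s - q ^ i), ← Finset.prod_range_reflect,
    Nat.cast_prod]
  have h (j : ℕ) (hj : j ∈ Finset.range s) :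
      ((q ^ s - q ^ (s - 1 - j) : ℕ) : ℚ) = (q : ℚ) ^ s * (1 - (q : ℚ)⁻¹ ^ (j + 1)) := by
    rw [Finset.mem_range] at hj
    rw [Nat.cast_sub (Nat.pow_le_pow_right hq.le (by omega))]
    push_cast
    have : (q : ℚ) ^ s = q ^ (s - 1 - j) * q ^ (j + 1) := by
      rw [← pow_add]; congr 1; omega
    rw [mul_sub, mul_one, inv_pow]
    congr 1
    rw [this]
    field_simp
  rw [Finset.prod_congr rfl h, Finset.prod_mul_distrib, Finset.prod_const, Finset.card_range]
  simp [semilinearFormula, ← pow_mul, sq]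

theorem prod_one_sub_inv_pow_ne_zero (q : ℚ) (hq : 1 < q) (n : ℕ) :
    ∏ j ∈ Finset.range n, (1 - q⁻¹ ^ (j + 1)) ≠ 0 := by
  refine Finset.prod_ne_zero_iff.2 fun j _ => ?_
  exact (sub_pos.2 (pow_lt_one₀ (by positivity) (inv_lt_one_of_one_lt₀ hq) j.succ_ne_zero)).ne'

theorem semilinearFormula_succ_zero (q : ℚ) (hq : 1 < q) (d s : ℕ) :
    semilinearFormula q (d + 1) 0 s * (q ^ (d + 1) - 1) =
      (q ^ (d + s + 1) - 1) * (semilinearFormula q d 0 s * q ^ s) := by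
  have hq0 : q ≠ 0 := by positivity
  have h1 := prod_one_sub_inv_pow_ne_zero q hq d
  have h2 := prod_one_sub_inv_pow_ne_zero q hq (d + 1)
  rw [Finset.prod_range_succ] at h2
  have h3 := right_ne_zero_of_mul h2
  have e1 : q ^ (d + 1) - 1 = q ^ (d + 1) * (1 - q⁻¹ ^ (d + 1)) := by
    rw [mul_sub, ← mul_pow, mul_inv_cancel₀ hq0]; simp
  have e2 : q ^ (d + s + 1) - 1 = q ^ (d + s + 1) * (1 - q⁻¹ ^ (d + s + 1)) := by
    rw [mul_sub, ← mul_pow, mul_inv_cancel₀ hq0]; simp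
  rw [e1, e2]
  simp only [semilinearFormula, show d + 1 + 0 + s = d + s + 1 by ring,
    show d + 0 + s = d + s by ring, Finset.prod_range_succ, Finset.prod_range_zero, mul_one, one_mul]
  generalize 1 - q⁻¹ ^ (d + 1) = x at *
  generalize 1 - q⁻¹ ^ (d + s + 1) = y at *
  generalize ∏ j ∈ Finset.range d, (1 - q⁻¹ ^ (j + 1)) = z at *
  field_simp
  ring

theorem semilinearFormula_succ_succ (q : ℚ) (hq : 1 < q) (d e s : ℕ) :
    semilinearFormula q (d + 1) (e + 1) s * (q ^ (d + 1) - 1) =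
      (q ^ (d + e + s + 2) - 1) * (semilinearFormula q d (e + 1) s * q ^ (e + 1 + s) +
        semilinearFormula q (d + 1) e s * (q ^ (d + e + s + 1) - q ^ (e + s))) := by
  have hq0 : q ≠ 0 := by positivity
  have h1 := prod_one_sub_inv_pow_ne_zero q hq d
  have h2 := prod_one_sub_inv_pow_ne_zero q hq (d + 1)
  rw [Finset.prod_range_succ] at h2
  have h3 := right_ne_zero_of_mul h2
  have h4 := prod_one_sub_inv_pow_ne_zero q hq e
  have h5 := prod_one_sub_inv_pow_ne_zero q hq (e + 1)
  rw [Finset.prod_range_succ] at h5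
  have h6 := right_ne_zero_of_mul h5
  have e1 : q ^ (d + 1) - 1 = q ^ (d + 1) * (1 - q⁻¹ ^ (d + 1)) := by
    rw [mul_sub, ← mul_pow, mul_inv_cancel₀ hq0]; simp
  have e2 : q ^ (d + e + s + 2) - 1 = q ^ (d + e + s + 2) * (1 - q⁻¹ ^ (d + e + s + 2)) := by
    rw [mul_sub, ← mul_pow, mul_inv_cancel₀ hq0]; simp
  have e3 : q ^ (d + e + s + 1) - q ^ (e + s) = q ^ (d + e + s + 1) * (1 - q⁻¹ ^ (d + 1)) := by
    rw [show d + e + s + 1 = (d + 1) + (e + s) by ring, pow_add _ (d + 1), inv_pow]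
    field_simp
  have e4 : ∏ j ∈ Finset.range (e + 1), (1 - q⁻¹ ^ (d + j)) =
      (1 - q⁻¹ ^ d) * ∏ j ∈ Finset.range e, (1 - q⁻¹ ^ (d + 1 + j)) := by
    rw [Finset.prod_range_succ', mul_comm]
    simp [add_assoc, add_comm 1]
  have e5 : 1 - q⁻¹ ^ (d + 1 + e) = (1 - q⁻¹ ^ d) + q⁻¹ ^ d * (1 - q⁻¹ ^ (e + 1)) := by ring
  rw [e1, e2, e3]
  simp only [semilinearFormula, e4, show d + 1 + (e + 1) + s = d + e + s + 2 by ring,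
    show d + (e + 1) + s = d + e + s + 1 by ring, show d + 1 + e + s = d + e + s + 1 by ring,
    Finset.prod_range_succ _ (d + e + s + 1), Finset.prod_range_succ _ e,
    Finset.prod_range_succ _ d, e5, show d + e + s + 1 + 1 = d + e + s + 2 by ring]
  generalize ∏ j ∈ Finset.range (d + e + s + 1), (1 - q⁻¹ ^ (j + 1)) = t at *
  generalize 1 - q⁻¹ ^ (d + 1) = x at *
  generalize 1 - q⁻¹ ^ (e + 1) = w at *
  generalize 1 - q⁻¹ ^ (d + e + s + 2) = y at *
  generalize ∏ j ∈ Finset.range d, (1 - q⁻¹ ^ (j + 1)) = z at *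
  generalize ∏ j ∈ Finset.range e, (1 - q⁻¹ ^ (j + 1)) = u at *
  generalize ∏ j ∈ Finset.range e, (1 - q⁻¹ ^ (d + 1 + j)) = v at *
  generalize h : 1 - q⁻¹ ^ d = c at *
  rw [inv_pow]
  field_simp
  ring

theorem semilinearCount_eq {k V : Type*} [Field k] [Fintype k] [AddCommGroup V] [Module k V]
    [FiniteDimensional k V] (τ : k ≃+* k) (d s : ℕ) :
    (finrank k V < d + s → semilinearCount V τ d s = 0) ∧
    ∀ e, finrank k V = d + e + s →
      (semilinearCount V τ d s : ℚ) = semilinearFormula (Fintype.card k) d e s := by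
  have hq : 1 < Fintype.card k := Fintype.one_lt_card
  have hq' : (1 : ℚ) < Fintype.card k := by exact_mod_cast hq
  have hcard : Nat.card k = Fintype.card k := Nat.card_eq_fintype_card
  induction hn : finrank k V generalizing V d with
  | zero =>
    obtain _ | d := d
    · rw [semilinearCount_zero, hn]
      refine ⟨fun h => if_neg (by omega), fun e he => ?_⟩
      obtain ⟨rfl, rfl⟩ : e = 0 ∧ s = 0 := by omega
      rw [semilinearFormula_zero_zero _ hq]
      simp
    · refine ⟨fun _ => ?_, fun e he => by omega⟩
      rw [semilinearCount, Nat.card_eq_zero]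
      refine Or.inl ⟨fun ⟨F, hF, _⟩ => ?_⟩
      have := (LinearMap.ker F).finrank_le
      omega
  | succ n ih =>
    obtain _ | d := d
    · rw [semilinearCount_zero, hn]
      refine ⟨fun h => if_neg (by omega), fun e he => ?_⟩
      obtain _ | e := e
      · obtain rfl : n + 1 = s := by omega
        rw [semilinearFormula_zero_zero _ hq, if_pos rfl]
      · rw [semilinearFormula_zero_succ, if_neg (by omega), Nat.cast_zero]
    · obtain ⟨U₀, hU₀⟩ : ∃ U : Submodule k V, finrank k U = n := by
        have : Nontrivial V := Module.nontrivial_of_finrank_eq_succ hn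
        obtain ⟨v, hv⟩ := exists_ne (0 : V)
        obtain ⟨U, e, -⟩ := Submodule.exists_prod_equiv_of_ne_zero (k := k) v hv
        have := e.finrank_eq
        rw [Module.finrank_prod, hn, Module.finrank_self] at this
        exact ⟨U, by omega⟩
      have hpos : 0 < Fintype.card k ^ (d + 1) - 1 :=
        Nat.sub_pos_of_lt (Nat.one_lt_pow d.succ_ne_zero hq)
      have hrec := semilinearCount_mul τ d s n hn (fun d => semilinearCount U₀ τ d s) ?_
      · rw [hcard] at hrec
        refine ⟨fun h => ?_, fun e he => ?_⟩
        · rw [(ih (V := U₀) d hU₀).1 (by omega), (ih (V := U₀) (d + 1) hU₀).1 (by omega)] at hrec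
          simpa [hpos.ne'] using hrec
        · have hrec' := congrArg (Nat.cast : ℕ → ℚ) hrec
          have h1 (m : ℕ) : ((Fintype.card k ^ m - 1 : ℕ) : ℚ) = (Fintype.card k : ℚ) ^ m - 1 := by
            rw [Nat.cast_sub (Nat.one_le_pow _ _ (by omega))]; push_cast; rfl
          have hne : ((Fintype.card k ^ (d + 1) - 1 : ℕ) : ℚ) ≠ 0 := by exact_mod_cast hpos.ne'
          refine mul_right_cancel₀ hne ?_
          rw [← Nat.cast_mul, hrec', h1]
          obtain _ | e := e
          · obtain rfl : n = d + s := by omega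
            rw [(ih (V := U₀) (d + 1) hU₀).1 (by omega), semilinearFormula_succ_zero _ hq',
              ← (ih (V := U₀) d hU₀).2 0 (by omega), ← h1]
            simp
          · obtain rfl : n = d + e + s + 1 := by omega
            rw [semilinearFormula_succ_succ _ hq', ← (ih (V := U₀) d hU₀).2 (e + 1) (by omega),
              ← (ih (V := U₀) (d + 1) hU₀).2 e (by omega), ← h1,
              show d + e + s + 1 - d = e + 1 + s by omega,
              show d + e + s + 1 - (d + 1) = e + s by omega, Nat.cast_mul, Nat.cast_add,
              Nat.cast_mul, Nat.cast_mul,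
              Nat.cast_sub (Nat.pow_le_pow_right hq.le (by omega : e + s ≤ d + e + s + 1))]
            push_cast
            rfl
      · intro U hU d
        rcases lt_or_ge n (d + s) with h | h
        · rw [(ih (V := U) d hU).1 h, (ih (V := U₀) d hU₀).1 h]
        · obtain ⟨e, he⟩ := Nat.exists_eq_add_of_le h
          have he' : n = d + e + s := by omega
          exact_mod_cast ((ih (V := U) d hU).2 e he').trans ((ih (V := U₀) d hU₀).2 e he').symm

theorem Submodule.finrank_span_eq_iff_card {k V : Type*} [Field k] [Finite k] [AddCommGroup V]
    [Module k V] [FiniteDimensional k V] (p : Submodule k V) (t : ℕ) :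
    finrank k (Submodule.span k (p : Set V)) = t ↔ Nat.card p = Nat.card k ^ t := by
  rw [Submodule.span_eq, Module.natCard_eq_pow_finrank (K := k),
    Nat.pow_right_inj Finite.one_lt_card]

theorem finrank_range_add_finrank_ker_semilinear {k V : Type*} [Field k] [Finite k]
    [AddCommGroup V] [Module k V] [FiniteDimensional k V] (τ : k ≃+* k)
    (F : V →ₛₗ[(τ : k →+* k)] V) :
    finrank k (LinearMap.range F) + finrank k (LinearMap.ker F) = finrank k V := by
  have h := AddSubgroup.card_eq_card_quotient_mul_card_addSubgroup F.toAddMonoidHom.ker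
  rw [Nat.card_congr (QuotientAddGroup.quotientKerEquivRange F.toAddMonoidHom).toEquiv] at h
  have h1 : Nat.card F.toAddMonoidHom.ker = _ :=
    Module.natCard_eq_pow_finrank (K := k) (V := LinearMap.ker F)
  have h2 : Nat.card F.toAddMonoidHom.range = _ :=
    Module.natCard_eq_pow_finrank (K := k) (V := LinearMap.range F)
  rw [h1, h2, Module.natCard_eq_pow_finrank (K := k), ← pow_add,
    Nat.pow_right_inj Finite.one_lt_card] at h
  exact h.symm

theorem exists_submodule_eq_range_iterate {k V : Type*} [Field k]
    [AddCommGroup V] [Module k V] (τ : k ≃+* k) (F : V →ₛₗ[(τ : k →+* k)] V) (n : ℕ) :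
    ∃ p : Submodule k V, (p : Set V) = Set.range F^[n] := by
  induction n with
  | zero => exact ⟨⊤, by simp⟩
  | succ n ih =>
    obtain ⟨p, hp⟩ := ih
    exact ⟨p.map F, by rw [Submodule.map_coe, hp, iterate_succ', Set.range_comp]⟩

theorem finrank_span_iInter_range_iterate_eq_iff {k V : Type*} [Field k] [Finite k]
    [AddCommGroup V] [Module k V] [FiniteDimensional k V] (τ : k ≃+* k)
    (F : V →ₛₗ[(τ : k →+* k)] V) (s : ℕ) :
    finrank k (Submodule.span k (⋂ n : ℕ, Set.range F^[n])) = s ↔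
      Nat.card (periodicPts F) = Nat.card k ^ s := by
  have : Finite V := Module.finite_of_finite k
  choose p hp using exists_submodule_eq_range_iterate τ F
  have h : ((⨅ n, p n : Submodule k V) : Set V) = ⋂ n : ℕ, Set.range F^[n] := by
    simp [Submodule.coe_iInf, hp]
  rw [← range_iterate_iInter_eq_periodicPts, ← h, Submodule.finrank_span_eq_iff_card]
  rfl

theorem card_addMonoidHom_eq_semilinearCount {k V : Type*} [Field k] [Fintype k] [AddCommGroup V]
    [Module k V] [FiniteDimensional k V] (τ : k ≃+* k) (r s : ℕ) (hr : r ≤ finrank k V) :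
    Nat.card {F : V →+ V // (∀ (a : k) (v : V), F (a • v) = τ a • F v) ∧
        Module.finrank k (Submodule.span k (Set.range F)) = r ∧
        Module.finrank k (Submodule.span k (⋂ n : ℕ, Set.range ((⇑F)^[n]))) = s} =
      semilinearCount V τ (finrank k V - r) s := by
  have key (F : V →ₛₗ[(τ : k →+* k)] V) :
      (Module.finrank k (Submodule.span k (Set.range F)) = r ∧
        Module.finrank k (Submodule.span k (⋂ n : ℕ, Set.range ((⇑F)^[n]))) = s) ↔
      (finrank k (LinearMap.ker F) = finrank k V - r ∧
        Nat.card (periodicPts F) = Nat.card k ^ s) := by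
    rw [finrank_span_iInter_range_iterate_eq_iff, ← LinearMap.coe_range, Submodule.span_eq]
    have := finrank_range_add_finrank_ker_semilinear τ F
    refine and_congr_left fun _ => ?_
    omega
  refine Nat.card_congr
    { toFun := fun F => ⟨{ F.1 with map_smul' := F.2.1 }, (key _).1 F.2.2⟩
      invFun := fun F => ⟨F.1.toAddMonoidHom, F.1.map_smulₛₗ, (key F.1).2 F.2⟩
      left_inv := fun _ => rfl
      right_inv := fun _ => rfl }

/-- Theorem 1.1 (main): the number of τ-semilinear endomorphisms of a g-dimensional
vector space over a finite field of order q with rank r and infinity rank s. -/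
theorem count_semilinear_rank_infrank
    {k V : Type*} [Field k] [Fintype k] [AddCommGroup V] [Module k V]
    [FiniteDimensional k V]
    (q g r s : ℕ) (hq : Fintype.card k = q) (hg : Module.finrank k V = g)
    (τ : k ≃+* k) (hsr : s ≤ r) (hrg : r ≤ g) :
    (Nat.card {F : V →+ V // (∀ (a : k) (v : V), F (a • v) = τ a • F v) ∧
        Module.finrank k (Submodule.span k (Set.range F)) = r ∧
        Module.finrank k (Submodule.span k (⋂ n : ℕ, Set.range ((⇑F)^[n]))) = s} : ℚ) =
      (q : ℚ) ^ (g ^ 2) / (q : ℚ) ^ ((g - r) ^ 2 + (r - s)) *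
        ((∏ j ∈ Finset.Icc 1 g, (1 - ((q : ℚ))⁻¹ ^ j)) *
         (∏ j ∈ Finset.Icc ((g : ℤ) - r) ((g : ℤ) - s - 1), (1 - ((q : ℚ))⁻¹ ^ j))) /
        ((∏ j ∈ Finset.Icc 1 (r - s), (1 - ((q : ℚ))⁻¹ ^ j)) *
         (∏ j ∈ Finset.Icc 1 (g - r), (1 - ((q : ℚ))⁻¹ ^ j))) := by
  subst hq
  obtain ⟨d, rfl⟩ := Nat.exists_eq_add_of_le hrg
  obtain ⟨e, rfl⟩ := Nat.exists_eq_add_of_le hsr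
  rw [card_addMonoidHom_eq_semilinearCount τ _ s (by omega), hg, Nat.add_sub_cancel_left,
    Nat.add_sub_cancel_left, (semilinearCount_eq τ d s).2 e (by omega), semilinearFormula]
  have h1 (n : ℕ) : ∏ j ∈ Finset.Icc 1 n, (1 - (Fintype.card k : ℚ)⁻¹ ^ j) =
      ∏ j ∈ Finset.range n, (1 - (Fintype.card k : ℚ)⁻¹ ^ (j + 1)) := by
    rw [Finset.range_eq_Ico, Finset.prod_Ico_add' (fun j => 1 - (Fintype.card k : ℚ)⁻¹ ^ j) 0 n 1]
    rfl
  have h2 : ∏ j ∈ Finset.Icc (((s + e + d : ℕ) : ℤ) - (s + e : ℕ)) (((s + e + d : ℕ) : ℤ) - s - 1),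
      (1 - (Fintype.card k : ℚ)⁻¹ ^ j) =
      ∏ j ∈ Finset.range e, (1 - (Fintype.card k : ℚ)⁻¹ ^ (d + j)) := by
    symm
    refine Finset.prod_bij (fun j _ => ((d + j : ℕ) : ℤ)) ?_ ?_ ?_ ?_
    · intro j hj
      simp only [Finset.mem_range, Finset.mem_Icc] at *
      omega
    · intro i _ j _ h
      omega
    · intro j hj
      simp only [Finset.mem_Icc] at hj
      refine ⟨(j - d).toNat, ?_, ?_⟩
      · simp only [Finset.mem_range]; omega
      · omega
    · intro j _
      rw [zpow_natCast]
  rw [h1, h1, h1, h2, show s + e + d = d + e + s by ring]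
end

section
/- Let k be a finite field of order q, let τ be a field automorphism of k, and let V be a k-vector space of dimension g. For nonnegative integers r, s with s ≤ r ≤ g, the number of τ-semilinear endomorphisms F of V with rk(F) = r and rk_∞(F) = s equals q^{s(g-s)} · (∏_{i=0}^{r-s-1} (q^{g-s} - q^i) / ∏_{i=0}^{r-s-1} (q^{r-s} - q^i)) · ∏_{i=0}^{r-s-1} (q^{g-s-1} - q^i) · ∏_{i=0}^{s-1} (q^g - q^i), where an empty product equals 1. -/
theorem Nat.card_subtype_eq_sum_card_fiber {α β : Type*} [Finite α] [Fintype β] (f : α → β)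
    (p : β → Prop) [DecidablePred p] (Q : α → Prop) :
    Nat.card {a // p (f a) ∧ Q a} = ∑ b with p b, Nat.card {a // f a = b ∧ Q a} := by
  classical
  have := Fintype.ofFinite α
  simp only [Nat.card_eq_fintype_card, Fintype.card_subtype]
  rw [Finset.card_eq_sum_card_fiberwise (f := f) (t := Finset.univ.filter p)]
  · refine Finset.sum_congr rfl fun b hb ↦ ?_
    congr 1
    ext a
    simp only [Finset.mem_filter, Finset.mem_univ, true_and] at hb ⊢
    grind
  · intro a
    simp +contextual

/-- The product `∏ i < b, (q ^ a - q ^ i)`, counting the linearly independent `b`-tuples in an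
`a`-dimensional space over a field with `q` elements. -/
def qDescFactorial (q a b : ℕ) : ℕ := ∏ i ∈ Finset.range b, (q ^ a - q ^ i)

theorem qDescFactorial_eq_zero (q : ℕ) {a b : ℕ} (h : a < b) : qDescFactorial q a b = 0 :=
  Finset.prod_eq_zero (Finset.mem_range.2 h) (Nat.sub_self _)

theorem cast_qDescFactorial {q : ℕ} (hq : 0 < q) (a b : ℕ) :
    (qDescFactorial q a b : ℚ) = ∏ i ∈ Finset.range b, ((q : ℚ) ^ a - (q : ℚ) ^ i) := by
  rcases lt_or_ge a b with h | h
  · rw [qDescFactorial_eq_zero q h, Finset.prod_eq_zero (Finset.mem_range.2 h) (sub_self _)]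
    simp
  · rw [qDescFactorial, Nat.cast_prod]
    refine Finset.prod_congr rfl fun i hi ↦ ?_
    rw [Nat.cast_sub (Nat.pow_le_pow_right hq ((Finset.mem_range.1 hi).le.trans h))]
    simp

theorem qDescFactorial_add (q a b c : ℕ) :
    qDescFactorial q (a + b) (a + c) =
      qDescFactorial q (a + b) a * (q ^ (a * c) * qDescFactorial q b c) := by
  rw [qDescFactorial, Finset.prod_range_add]
  congr 1
  rw [qDescFactorial, pow_mul, ← Finset.card_range c, ← Finset.prod_const, Finset.card_range,
    ← Finset.prod_mul_distrib]
  refine Finset.prod_congr rfl fun i _ ↦ ?_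
  rw [pow_add, pow_add, Nat.mul_sub]

theorem qDescFactorial_succ_succ (q m j : ℕ) (hq : 0 < q) :
    qDescFactorial q (m + 1) (j + 1) =
      qDescFactorial q m (j + 1) + (q ^ (j + 1) - 1) * q ^ m * qDescFactorial q m j := by
  have h1 := qDescFactorial_add q 1 m j
  rw [add_comm 1 m, add_comm 1 j] at h1
  have h2 : qDescFactorial q m (j + 1) = qDescFactorial q m j * (q ^ m - q ^ j) :=
    Finset.prod_range_succ _ _
  have h3 : qDescFactorial q (m + 1) 1 = q ^ (m + 1) - 1 := by simp [qDescFactorial]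
  rw [h1, h2, h3]
  rcases lt_or_ge m j with h | h
  · simp [qDescFactorial_eq_zero q h]
  · have e1 : q ^ j ≤ q ^ m := Nat.pow_le_pow_right hq h
    have e2 : 1 ≤ q ^ (m + 1) := Nat.one_le_pow _ _ hq
    have e3 : 1 ≤ q ^ (j + 1) := Nat.one_le_pow _ _ hq
    zify [e1, e2, e3]
    ring

/-- The number of `m`-tuples which together with `K` span `W`. -/
theorem card_sup_span_range_eq {k V : Type*} [Field k] [Finite k] [AddCommGroup V] [Module k V]
    [FiniteDimensional k V] (m : ℕ) {K W : Submodule k V} (hKW : K ≤ W) :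
    Nat.card {w : Fin m → V // K ⊔ Submodule.span k (Set.range w) = W} =
      Nat.card k ^ (m * Module.finrank k K) *
        qDescFactorial (Nat.card k) m (Module.finrank k W - Module.finrank k K) := by
  classical
  have : Finite V := Module.finite_of_finite k
  have := Fintype.ofFinite V
  have hcard (U : Submodule k V) :
      (Finset.univ.filter (· ∈ U)).card = Nat.card k ^ Module.finrank k U := by
    rw [← Module.natCard_eq_pow_finrank, ← Fintype.card_subtype, ← Nat.card_eq_fintype_card]
  induction m generalizing K with
  | zero =>
    rcases eq_or_lt_of_le hKW with rfl | h
    · simp [qDescFactorial, Set.range_eq_empty]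
    · rw [qDescFactorial_eq_zero _ (Nat.sub_pos_of_lt (Submodule.finrank_lt_finrank_of_lt h))]
      simp [Set.range_eq_empty, h.ne]
  | succ m ih =>
    have key : Nat.card {w : Fin (m + 1) → V // K ⊔ Submodule.span k (Set.range w) = W} =
        ∑ v : V, Nat.card {w : Fin m → V //
          (K ⊔ Submodule.span k {v}) ⊔ Submodule.span k (Set.range w) = W} := by
      rw [← Nat.card_sigma]
      refine Nat.card_congr ⟨fun w ↦ ⟨w.1 0, Fin.tail w.1, ?_⟩,
        fun w ↦ ⟨Fin.cons w.1 w.2.1, ?_⟩, fun w ↦ ?_, fun w ↦ ?_⟩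
      · rw [sup_assoc, ← Submodule.span_union, Set.singleton_union, ← Fin.range_cons,
          Fin.cons_self_tail]
        exact w.2
      · rw [Fin.range_cons, Set.insert_eq, Submodule.span_union, ← sup_assoc]
        exact w.2.2
      · simp
      · obtain ⟨v, w, hw⟩ := w
        rfl
    set q := Nat.card k
    have hq : 0 < q := Nat.card_pos
    set d := Module.finrank k K with hd
    set e := Module.finrank k W with he
    have hde : d ≤ e := Submodule.finrank_mono hKW
    have hterm (v : V) : Nat.card {w : Fin m → V //
          (K ⊔ Submodule.span k {v}) ⊔ Submodule.span k (Set.range w) = W} =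
        (if v ∈ K then q ^ (m * d) * qDescFactorial q m (e - d) else 0) +
        (if v ∈ W ∧ v ∉ K then q ^ (m * (d + 1)) * qDescFactorial q m (e - (d + 1)) else 0) := by
      by_cases hvW : v ∈ W
      · by_cases hvK : v ∈ K
        · have : K ⊔ Submodule.span k {v} = K := by simpa
          simp only [this, hvK, ih hKW]
          simp [d]
        · have hdim : Module.finrank k ↥(K ⊔ Submodule.span k {v}) = d + 1 :=
            Submodule.finrank_sup_span_singleton hvK
          rw [ih (sup_le hKW (by simpa)), hdim]
          simp [hvW, hvK]
      · have hvK : v ∉ K := fun h ↦ hvW (hKW h)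
        simp only [hvW, hvK, if_false, false_and, add_zero]
        rw [Nat.card_eq_zero]
        refine .inl ⟨fun w ↦ hvW ?_⟩
        rw [← w.2]
        exact Submodule.mem_sup_left (Submodule.mem_sup_right (Submodule.mem_span_singleton_self v))
    have hdiff : (Finset.univ.filter fun v ↦ v ∈ W ∧ v ∉ K).card = q ^ e - q ^ d := by
      rw [← hcard, ← hcard, ← Finset.card_sdiff_of_subset]
      · congr 1
        ext; simp
      · intro v
        simpa using @hKW v
    rw [key, Finset.sum_congr rfl fun v _ ↦ hterm v, Finset.sum_add_distrib, ← Finset.sum_filter,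
      ← Finset.sum_filter, Finset.sum_const, Finset.sum_const, hcard, hdiff]
    obtain ⟨j, hj | hj⟩ : ∃ j, e = d ∨ e = d + (j + 1) := ⟨e - d - 1, by omega⟩
    · simp [hj, qDescFactorial, ← pow_add, ← hd, Nat.add_mul, add_comm]
    · rw [hj, Nat.add_sub_cancel_left, show d + (j + 1) - (d + 1) = j by omega,
        qDescFactorial_succ_succ _ _ _ hq, pow_add q d (j+1)]
      simp only [smul_eq_mul]
      have e3 : 1 ≤ q ^ (j + 1) := Nat.one_le_pow _ _ hq
      have e4 : q ^ d ≤ q ^ d * q ^ (j + 1) := Nat.le_mul_of_pos_right _ e3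
      zify [e3, e4]
      ring

theorem card_linearIndependent_span_le {k V : Type*} [Field k] [Finite k] [AddCommGroup V]
    [Module k V] [FiniteDimensional k V] (s : ℕ) (W : Submodule k V) :
    Nat.card {v : Fin s → V // Submodule.span k (Set.range v) ≤ W ∧ LinearIndependent k v} =
      qDescFactorial (Nat.card k) (Module.finrank k W) s := by
  have e : {v : Fin s → V // Submodule.span k (Set.range v) ≤ W ∧ LinearIndependent k v} ≃
      {v : Fin s → W // LinearIndependent k v} :=
    { toFun v := ⟨fun i ↦ ⟨v.1 i, v.2.1 (Submodule.subset_span ⟨i, rfl⟩)⟩,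
        LinearIndependent.of_comp W.subtype v.2.2⟩
      invFun v := ⟨fun i ↦ v.1 i, by
        rw [Submodule.span_le]; rintro _ ⟨i, rfl⟩; exact (v.1 i).2,
        v.2.map' W.subtype W.ker_subtype⟩
      left_inv v := rfl
      right_inv v := rfl }
  have := Fintype.ofFinite k
  have : Finite V := Module.finite_of_finite k
  rw [Nat.card_congr e]
  rcases le_or_gt s (Module.finrank k W) with h | h
  · rw [card_linearIndependent h, qDescFactorial, Finset.prod_range, Nat.card_eq_fintype_card]
  · rw [qDescFactorial_eq_zero _ h, Nat.card_eq_zero]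
    refine .inl ⟨fun v ↦ h.not_ge ?_⟩
    simpa using v.2.fintype_card_le_finrank

theorem card_span_range_le {k V : Type*} [Field k] [Finite k] [AddCommGroup V]
    [Module k V] [FiniteDimensional k V] (m : ℕ) (W : Submodule k V) :
    Nat.card {v : Fin m → V // Submodule.span k (Set.range v) ≤ W} =
      Nat.card k ^ (m * Module.finrank k W) := by
  have e : {v : Fin m → V // Submodule.span k (Set.range v) ≤ W} ≃ (Fin m → W) :=
    { toFun v i := ⟨v.1 i, v.2 (Submodule.subset_span ⟨i, rfl⟩)⟩
      invFun v := ⟨fun i ↦ v i, by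
        rw [Submodule.span_le]; rintro _ ⟨i, rfl⟩; exact (v i).2⟩
      left_inv v := rfl
      right_inv v := rfl }
  rw [Nat.card_congr e, Nat.card_fun, Module.natCard_eq_pow_finrank (K := k) (V := W), ← pow_mul,
    Nat.card_fin, mul_comm]

/-- Sorting the pairs of a linearly independent `s`-tuple and an `m`-tuple in `U` by the subspace
they span. -/
theorem sum_qDescFactorial_finrank {k V : Type*} [Field k] [Finite k] [AddCommGroup V]
    [Module k V] [FiniteDimensional k V] [Fintype (Submodule k V)] [DecidableLE (Submodule k V)]
    (s m : ℕ) (U : Submodule k V) :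
    ∑ W : Submodule k V with W ≤ U, qDescFactorial (Nat.card k) (Module.finrank k W) s *
        qDescFactorial (Nat.card k) m (Module.finrank k W - s) =
      qDescFactorial (Nat.card k) (Module.finrank k U) s *
        Nat.card k ^ (m * (Module.finrank k U - s)) := by
  classical
  have : Finite V := Module.finite_of_finite k
  set q := Nat.card k
  have hq : 0 < q := Nat.card_pos
  rcases lt_or_ge (Module.finrank k U) s with h | h
  · rw [qDescFactorial_eq_zero _ h, zero_mul]
    refine Finset.sum_eq_zero fun W hW ↦ ?_
    rw [qDescFactorial_eq_zero, zero_mul]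
    exact (Submodule.finrank_mono (Finset.mem_filter.1 hW).2).trans_lt h
  let α := {v : Fin s → V // LinearIndependent k v}
  have := Fintype.ofFinite α
  let sp {j : ℕ} (w : Fin j → V) : Submodule k V := Submodule.span k (Set.range w)
  have hfin (v : α) : Module.finrank k (sp v.1) = s := by
    simpa using finrank_span_eq_card v.2
  have hα (W : Submodule k V) : (Finset.univ.filter fun v : α ↦ sp v.1 ≤ W).card =
      qDescFactorial q (Module.finrank k W) s := by
    rw [← card_linearIndependent_span_le, ← Fintype.card_subtype, ← Nat.card_eq_fintype_card]
    exact Nat.card_congr ((Equiv.subtypeSubtypeEquivSubtypeInter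
      (fun v : Fin s → V ↦ LinearIndependent k v)
      fun v : Fin s → V ↦ sp v ≤ W).trans
      (Equiv.subtypeEquivRight fun v ↦ and_comm))
  have hfiber (v : α) (W : Submodule k V) :
      Nat.card {w : Fin m → V // sp v.1 ⊔ sp w = W} =
        if sp v.1 ≤ W then q ^ (m * s) * qDescFactorial q m (Module.finrank k W - s) else 0 := by
    split_ifs with hv
    · rw [card_sup_span_range_eq m hv, hfin]
    · rw [Nat.card_eq_zero]
      exact .inl ⟨fun w ↦ hv (w.2 ▸ le_sup_left)⟩
  have hle (v : α) : Nat.card {w : Fin m → V // sp v.1 ⊔ sp w ≤ U} =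
        if sp v.1 ≤ U then q ^ (m * Module.finrank k U) else 0 := by
    split_ifs with hv
    · rw [← card_span_range_le]
      exact Nat.card_congr (Equiv.subtypeEquivRight fun w ↦ by simp [hv, sp])
    · rw [Nat.card_eq_zero]
      exact .inl ⟨fun w ↦ hv (le_sup_left.trans w.2)⟩
  have hsum (v : α) : Nat.card {w : Fin m → V // sp v.1 ⊔ sp w ≤ U} =
      ∑ W : Submodule k V with W ≤ U, Nat.card {w : Fin m → V // sp v.1 ⊔ sp w = W} := by
    simpa using Nat.card_subtype_eq_sum_card_fiber (fun w : Fin m → V ↦ sp v.1 ⊔ sp w)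
      (· ≤ U) (fun _ ↦ True)
  have htot := Finset.sum_congr rfl fun v (_ : v ∈ (Finset.univ : Finset α)) ↦ hsum v
  rw [Finset.sum_comm] at htot
  simp_rw [hfiber, hle, ← Finset.sum_filter, Finset.sum_const, hα, smul_eq_mul] at htot
  refine Nat.eq_of_mul_eq_mul_left (pow_pos hq (m * s)) ?_
  rw [Finset.mul_sum, mul_left_comm, ← pow_add, ← Nat.mul_add, Nat.add_sub_cancel' h, htot]
  exact Finset.sum_congr rfl fun W _ ↦ by ring

/-- The number of `r`-dimensional subspaces, in product form. -/
theorem card_finrank_eq_mul_qDescFactorial {k V : Type*} [Field k] [Finite k] [AddCommGroup V]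
    [Module k V] [FiniteDimensional k V] [Fintype (Submodule k V)] (r : ℕ) :
    (Finset.univ.filter fun W : Submodule k V ↦ Module.finrank k W = r).card *
        qDescFactorial (Nat.card k) r r =
      qDescFactorial (Nat.card k) (Module.finrank k V) r := by
  classical
  have : Finite V := Module.finite_of_finite k
  have h1 := card_linearIndependent_span_le r (⊤ : Submodule k V)
  have h2 := Nat.card_subtype_eq_sum_card_fiber
    (fun w : Fin r → V ↦ Submodule.span k (Set.range w)) (fun W ↦ Module.finrank k W = r)
      (fun _ ↦ True)
  simp only [le_top, true_and, and_true, finrank_top, linearIndependent_iff_card_eq_finrank_span,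
    Set.finrank, Fintype.card_fin] at h1 h2
  simp only [eq_comm (a := r)] at h1
  rw [← h1, h2, Finset.sum_const_nat fun W hW ↦ ?_]
  have h3 := card_sup_span_range_eq r (bot_le : ⊥ ≤ W)
  simpa [(Finset.mem_filter.1 hW).2] using h3

section Semilinear

variable {k : Type*} [Field k]

/-- The dimension of the span of the terminal image of a self-map. -/
noncomputable def infinityRank (k : Type*) [Field k] {V : Type*} [AddCommGroup V] [Module k V]
    (F : V → V) : ℕ :=
  Module.finrank k (Submodule.span k (⋂ n : ℕ, Set.range F^[n]))

theorem infinityRank_of_surjective {V : Type*} [AddCommGroup V] [Module k V] {F : V → V}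
    (hF : Function.Surjective F) : infinityRank k F = Module.finrank k V := by
  have h : (⋂ n : ℕ, Set.range F^[n]) = Set.univ :=
    Set.iInter_eq_univ.2 fun n ↦ (hF.iterate n).range_eq
  rw [infinityRank, h, Submodule.span_univ, finrank_top]

theorem span_range_eq_top_of_infinityRank {V : Type*} [AddCommGroup V] [Module k V]
    [FiniteDimensional k V] {F : V → V} (hF : infinityRank k F = Module.finrank k V) :
    Submodule.span k (Set.range F) = ⊤ := by
  rw [eq_top_iff, ← Submodule.eq_top_of_finrank_eq hF]
  exact Submodule.span_mono (Set.iInter_subset _ 1)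

/-- The infinity rank is unchanged by restriction to a subspace containing the image. -/
theorem infinityRank_eq_of_commute {V : Type*} [AddCommGroup V] [Module k V] {U : Submodule k V}
    {F : V → V} {G : U → U} (hU : ∀ v, F v ∈ U) (hG : ∀ u, (G u : V) = F u) :
    infinityRank k F = infinityRank k G := by
  have hiter (n : ℕ) (u : U) : (G^[n] u : V) = F^[n] u :=
    Function.Semiconj.iterate_right (f := ((↑) : U → V)) hG n u
  have himage : (⋂ n : ℕ, Set.range F^[n]) = U.subtype '' ⋂ n : ℕ, Set.range G^[n] := by
    ext x
    simp only [Set.mem_iInter, Set.mem_range, Set.mem_image, Submodule.subtype_apply]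
    constructor
    · intro h
      obtain ⟨y, rfl⟩ := h 1
      refine ⟨⟨F y, hU y⟩, fun n ↦ ?_, rfl⟩
      obtain ⟨z, hz⟩ := h (n + 1)
      exact ⟨⟨F z, hU z⟩, Subtype.ext <| by rw [hiter]; exact hz⟩
    · rintro ⟨x, h, rfl⟩ n
      obtain ⟨z, rfl⟩ := h n
      exact ⟨z, (hiter n z).symm⟩
  rw [infinityRank, himage, ← Submodule.map_span, Submodule.finrank_map_subtype_eq]
  rfl

variable (τ : k ≃+* k)

theorem semilinear_surjective_of_span_range_eq_top {V : Type*} [AddCommGroup V] [Module k V]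
    {F : V →ₛₗ[(τ : k →+* k)] V} (hF : Submodule.span k (Set.range F) = ⊤) :
    Function.Surjective F := by
  intro v
  have hv : v ∈ Submodule.span k (Set.range F) := hF ▸ Submodule.mem_top
  induction hv using Submodule.span_induction with
  | mem x h => exact h
  | zero => exact ⟨0, map_zero F⟩
  | add x y _ _ hx hy =>
    obtain ⟨a, rfl⟩ := hx
    obtain ⟨b, rfl⟩ := hy
    exact ⟨a + b, map_add F a b⟩
  | smul a x _ hx =>
    obtain ⟨b, rfl⟩ := hx
    exact ⟨τ.symm a • b, by simp⟩

/-- A semilinear map is determined by arbitrary images of the basis vectors. -/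
noncomputable def Module.Basis.semilinearEquiv {ι V X : Type*} [Fintype ι] [AddCommGroup V]
    [Module k V] [AddCommGroup X] [Module k X] (b : Module.Basis ι k V) :
    (V →ₛₗ[(τ : k →+* k)] X) ≃ (ι → X) where
  toFun F i := F (b i)
  invFun w :=
    { toFun v := ∑ i, τ (b.repr v i) • w i
      map_add' v v' := by simp [add_smul, Finset.sum_add_distrib]
      map_smul' a v := by simp [mul_smul, Finset.smul_sum] }
  left_inv F := b.ext fun i ↦ by
    classical
    simp [Finsupp.single_apply, apply_ite, ite_smul]
  right_inv w := by
    classical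
    ext i
    simp [Finsupp.single_apply, apply_ite, ite_smul]

theorem span_range_semilinear {ι V X : Type*} [Fintype ι] [AddCommGroup V]
    [Module k V] [AddCommGroup X] [Module k X] (b : Module.Basis ι k V)
    (F : V →ₛₗ[(τ : k →+* k)] X) :
    Submodule.span k (Set.range F) =
      Submodule.span k (Set.range (b.semilinearEquiv τ F)) := by
  refine le_antisymm (Submodule.span_le.2 ?_) (Submodule.span_mono ?_)
  · rintro _ ⟨v, rfl⟩
    rw [← b.sum_repr v, map_sum F]
    refine Submodule.sum_mem _ fun i _ ↦ ?_
    rw [map_smulₛₗ F]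
    exact Submodule.smul_mem _ _ (Submodule.subset_span ⟨i, rfl⟩)
  · rintro _ ⟨i, rfl⟩
    exact ⟨b i, rfl⟩

instance [Finite k] {V X : Type*} [AddCommGroup V] [Module k V] [FiniteDimensional k V]
    [AddCommGroup X] [Module k X] [FiniteDimensional k X] :
    Finite (V →ₛₗ[(τ : k →+* k)] X) :=
  have : Finite X := Module.finite_of_finite k
  Finite.of_equiv _ ((Module.finBasis k V).semilinearEquiv τ).symm

theorem card_semilinear [Finite k] {V X : Type*} [AddCommGroup V] [Module k V]
    [FiniteDimensional k V] [AddCommGroup X] [Module k X] [FiniteDimensional k X] :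
    Nat.card (V →ₛₗ[(τ : k →+* k)] X) =
      Nat.card k ^ (Module.finrank k X * Module.finrank k V) := by
  rw [Nat.card_congr ((Module.finBasis k V).semilinearEquiv τ), Nat.card_fun,
    Module.natCard_eq_pow_finrank (K := k) (V := X), ← pow_mul, Nat.card_fin]

theorem card_semilinear_span_range_eq_top [Finite k] {V : Type*} [AddCommGroup V] [Module k V]
    [FiniteDimensional k V] :
    Nat.card {F : V →ₛₗ[(τ : k →+* k)] V // Submodule.span k (Set.range F) = ⊤} =
      qDescFactorial (Nat.card k) (Module.finrank k V) (Module.finrank k V) := by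
  have h := card_sup_span_range_eq (Module.finrank k V) (bot_le : (⊥ : Submodule k V) ≤ ⊤)
  rw [finrank_bot, finrank_top, mul_zero, pow_zero, one_mul, Nat.sub_zero] at h
  rw [← h]
  refine Nat.card_congr (((Module.finBasis k V).semilinearEquiv τ).subtypeEquiv fun F ↦ ?_)
  rw [bot_sup_eq, span_range_semilinear τ (Module.finBasis k V)]

/-- Every semilinear endomorphism of `U` has the same number of extensions to maps `V → U`. -/
theorem card_semilinear_restrict [Finite k] {V : Type*} [AddCommGroup V]
    [Module k V] [FiniteDimensional k V] (U : Submodule k V)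
    (P : (U →ₛₗ[(τ : k →+* k)] U) → Prop) :
    Nat.card {F : V →ₛₗ[(τ : k →+* k)] U // P (F.comp U.subtype)} =
      Nat.card {G // P G} *
        Nat.card k ^ (Module.finrank k U * (Module.finrank k V - Module.finrank k U)) := by
  obtain ⟨p, hp⟩ := U.subtype.exists_leftInverse_of_injective U.ker_subtype
  have hp' (u : U) : p u = u := LinearMap.congr_fun hp u
  let K := {H : V →ₛₗ[(τ : k →+* k)] U // H.comp U.subtype = 0}
  have key (P : (U →ₛₗ[(τ : k →+* k)] U) → Prop) :
      Nat.card {F : V →ₛₗ[(τ : k →+* k)] U // P (F.comp U.subtype)} =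
        Nat.card {G // P G} * Nat.card K := by
    rw [← Nat.card_prod]
    refine Nat.card_congr
      { toFun F := (⟨_, F.2⟩, ⟨F.1 - (F.1.comp U.subtype).comp p, by ext; simp [hp']⟩)
        invFun G := ⟨G.1.1.comp p + G.2.1, ?_⟩
        left_inv F := by ext; simp
        right_inv G := ?_ }
    · convert G.1.2
      rw [LinearMap.add_comp, G.2.2]
      ext; simp [hp']
    · obtain ⟨⟨G, hG⟩, H, hH⟩ := G
      have h1 : (G.comp p + H).comp U.subtype = G := by
        rw [LinearMap.add_comp, hH]
        ext; simp [hp']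
      simp [h1]
  have hU : Module.finrank k U ≤ Module.finrank k V := U.finrank_le
  have hq : 0 < Nat.card k := Nat.card_pos
  have hK := key fun _ ↦ True
  simp only [Nat.card_congr (Equiv.subtypeUnivEquiv fun _ ↦ trivial), card_semilinear] at hK
  rw [key]
  congr 1
  refine Nat.eq_of_mul_eq_mul_left (pow_pos hq (Module.finrank k U * Module.finrank k U)) ?_
  rw [← hK, ← pow_add, ← Nat.mul_add, Nat.add_sub_cancel' hU]

theorem card_semilinear_span_range_le [Finite k] {V : Type*} [AddCommGroup V]
    [Module k V] [FiniteDimensional k V] (U : Submodule k V) (s : ℕ) :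
    Nat.card {F : V →ₛₗ[(τ : k →+* k)] V //
        Submodule.span k (Set.range F) ≤ U ∧ infinityRank k F = s} =
      Nat.card {G : U →ₛₗ[(τ : k →+* k)] U // infinityRank k G = s} *
        Nat.card k ^ (Module.finrank k U * (Module.finrank k V - Module.finrank k U)) := by
  rw [← card_semilinear_restrict τ U fun G ↦ infinityRank k G = s]
  have hmem {F : V →ₛₗ[(τ : k →+* k)] V} (hF : Submodule.span k (Set.range F) ≤ U) (v : V) :
      F v ∈ U := hF (Submodule.subset_span ⟨v, rfl⟩)
  refine Nat.card_congr
    { toFun F := ⟨F.1.codRestrict U (hmem F.2.1), ?_⟩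
      invFun G := ⟨U.subtype.comp G.1, ?_, ?_⟩
      left_inv F := rfl
      right_inv G := rfl }
  · exact (infinityRank_eq_of_commute (hmem F.2.1) fun u ↦ rfl).symm.trans F.2.2
  · rw [Submodule.span_le]
    rintro _ ⟨v, rfl⟩
    exact (G.1 v).2
  · exact (infinityRank_eq_of_commute (fun v ↦ (G.1 v).2) fun u ↦ rfl).trans G.2

/-- The number of semilinear endomorphisms with image `W` and infinity rank `s`. -/
theorem card_semilinear_span_range_eq [Finite k] {V : Type*} [AddCommGroup V]
    [Module k V] [FiniteDimensional k V] (W : Submodule k V) (s : ℕ) :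
    Nat.card {F : V →ₛₗ[(τ : k →+* k)] V //
        Submodule.span k (Set.range F) = W ∧ infinityRank k F = s} =
      Nat.card k ^ (s * (Module.finrank k V - s)) *
        (qDescFactorial (Nat.card k) (Module.finrank k W) s *
          qDescFactorial (Nat.card k) (Module.finrank k V - s - 1) (Module.finrank k W - s)) := by
  classical
  induction hg : Module.finrank k V using Nat.strong_induction_on generalizing V with
  | _ g ihg =>
  have : Finite V := Module.finite_of_finite k
  have hq : 0 < Nat.card k := Nat.card_pos
  induction W using WellFoundedLT.induction with
  | _ W ihW =>
  rcases eq_or_lt_of_le (le_top : W ≤ ⊤) with rfl | hW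
  · have hrank {F : V →ₛₗ[(τ : k →+* k)] V} (hF : Submodule.span k (Set.range F) = ⊤) :
        infinityRank k F = g :=
      (infinityRank_of_surjective (semilinear_surjective_of_span_range_eq_top τ hF)).trans hg
    rw [finrank_top, hg]
    rcases lt_trichotomy g s with h | rfl | h
    · rw [qDescFactorial_eq_zero _ h, zero_mul, mul_zero, Nat.card_eq_zero]
      exact .inl ⟨fun F ↦ h.ne ((hrank F.2.1).symm.trans F.2.2)⟩
    · rw [Nat.card_congr (Equiv.subtypeEquivRight fun F ↦ and_iff_left_of_imp hrank),
        card_semilinear_span_range_eq_top, hg]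
      simp [qDescFactorial]
    · rw [qDescFactorial_eq_zero (b := g - s) _ (by omega), mul_zero, mul_zero, Nat.card_eq_zero]
      exact .inl ⟨fun F ↦ h.ne' ((hrank F.2.1).symm.trans F.2.2)⟩
  have hd : Module.finrank k W < g := hg ▸ Submodule.finrank_lt hW.ne
  have := Fintype.ofFinite (Submodule k V)
  have := Fintype.ofFinite (Submodule k W)
  have hN := Nat.card_subtype_eq_sum_card_fiber
    (fun F : V →ₛₗ[(τ : k →+* k)] V ↦ Submodule.span k (Set.range F)) (· ≤ W)
    (fun F ↦ infinityRank k F = s)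
  have hB := Nat.card_subtype_eq_sum_card_fiber
    (fun F : W →ₛₗ[(τ : k →+* k)] W ↦ Submodule.span k (Set.range F)) (· ≤ ⊤)
    (fun F ↦ infinityRank k F = s)
  simp_rw [ihg _ hd _ rfl, ← Finset.mul_sum] at hB
  rw [sum_qDescFactorial_finrank] at hB
  simp_rw [finrank_top, le_top, true_and] at hB
  rw [card_semilinear_span_range_le, hB, hg] at hN
  have hT := sum_qDescFactorial_finrank s (g - s - 1) W
  have hmem : W ∈ Finset.univ.filter (· ≤ W) := by simp
  rw [← Finset.add_sum_erase _ _ hmem] at hN hT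
  have hsum : ∑ W' ∈ (Finset.univ.filter (· ≤ W)).erase W, Nat.card {F : V →ₛₗ[(τ : k →+* k)] V //
        Submodule.span k (Set.range F) = W' ∧ infinityRank k F = s} =
      Nat.card k ^ (s * (g - s)) * ∑ W' ∈ (Finset.univ.filter (· ≤ W)).erase W,
        qDescFactorial (Nat.card k) (Module.finrank k W') s *
          qDescFactorial (Nat.card k) (g - s - 1) (Module.finrank k W' - s) := by
    rw [Finset.mul_sum]
    refine Finset.sum_congr rfl fun W' hW' ↦ ihW W' ?_
    simp only [Finset.mem_erase, Finset.mem_filter, Finset.mem_univ, true_and] at hW'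
    exact lt_of_le_of_ne hW'.2 hW'.1
  have hexp (d : ℕ) (hd : d < g) : Nat.card k ^ (s * (d - s)) * (qDescFactorial (Nat.card k) d s * Nat.card k ^ ((d - s - 1) * (d - s))) *
      Nat.card k ^ (d * (g - d)) =
      Nat.card k ^ (s * (g - s)) * (qDescFactorial (Nat.card k) d s * Nat.card k ^ ((g - s - 1) * (d - s))) := by
    rcases lt_or_ge d s with h | h
    · simp [qDescFactorial_eq_zero _ h]
    obtain ⟨a, rfl⟩ := Nat.exists_eq_add_of_le h
    obtain ⟨b, rfl⟩ := Nat.exists_eq_add_of_lt hd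
    have e1 : s + a - s = a := by omega
    have e2 : s + a + b + 1 - (s + a) = b + 1 := by omega
    have e3 : s + a + b + 1 - s = a + b + 1 := by omega
    rw [e1, e2, e3, Nat.add_sub_cancel]
    obtain _ | a := a
    · simp; ring
    · rw [Nat.add_sub_cancel]; ring
  rw [hsum, hexp _ hd, ← hT, mul_add] at hN
  exact (Nat.add_right_cancel hN).symm

end Semilinear

/-- The count of τ-semilinear endomorphisms with rank r and infinity rank s,
in the product form of equation (3.9) of the paper. -/
theorem count_semilinear_rank_infrank_product_form
    {k V : Type*} [Field k] [Fintype k] [AddCommGroup V] [Module k V]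
    [FiniteDimensional k V]
    (q g r s : ℕ) (hq : Fintype.card k = q) (hg : Module.finrank k V = g)
    (τ : k ≃+* k) (hsr : s ≤ r) (hrg : r ≤ g) :
    (Nat.card {F : V →+ V // (∀ (a : k) (v : V), F (a • v) = τ a • F v) ∧
        Module.finrank k (Submodule.span k (Set.range F)) = r ∧
        Module.finrank k (Submodule.span k (⋂ n : ℕ, Set.range ((⇑F)^[n]))) = s} : ℚ) =
      (q : ℚ) ^ (s * (g - s)) *
        ((∏ i ∈ Finset.range (r - s), ((q : ℚ) ^ (g - s) - (q : ℚ) ^ i)) /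
         (∏ i ∈ Finset.range (r - s), ((q : ℚ) ^ (r - s) - (q : ℚ) ^ i))) *
        (∏ i ∈ Finset.range (r - s), ((q : ℚ) ^ (g - s - 1) - (q : ℚ) ^ i)) *
        (∏ i ∈ Finset.range s, ((q : ℚ) ^ g - (q : ℚ) ^ i)) := by
  have : Finite V := Module.finite_of_finite k
  have := Fintype.ofFinite (Submodule k V)
  have hq1 : 1 < q := hq ▸ Fintype.one_lt_card
  have hq0 : 0 < q := by omega
  have hqk : Nat.card k = q := Nat.card_eq_fintype_card.trans hq
  have e : {F : V →+ V // (∀ (a : k) (v : V), F (a • v) = τ a • F v) ∧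
        Module.finrank k (Submodule.span k (Set.range F)) = r ∧
        Module.finrank k (Submodule.span k (⋂ n : ℕ, Set.range ((⇑F)^[n]))) = s} ≃
      {F : V →ₛₗ[(τ : k →+* k)] V // Module.finrank k (Submodule.span k (Set.range F)) = r ∧
        infinityRank k F = s} :=
    { toFun F := ⟨{ F.1 with map_smul' := F.2.1 }, F.2.2⟩
      invFun F := ⟨F.1.toAddMonoidHom, F.1.map_smulₛₗ, F.2⟩
      left_inv F := rfl
      right_inv F := rfl }
  classical
  have hcount := Nat.card_subtype_eq_sum_card_fiber
    (fun F : V →ₛₗ[(τ : k →+* k)] V ↦ Submodule.span k (Set.range F))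
    (fun W ↦ Module.finrank k W = r) (fun F ↦ infinityRank k F = s)
  rw [Finset.sum_const_nat (m := q ^ (s * (g - s)) *
      (qDescFactorial q r s * qDescFactorial q (g - s - 1) (r - s))) fun W hW ↦ by
    rw [card_semilinear_span_range_eq, (Finset.mem_filter.1 hW).2, hqk, hg]] at hcount
  have hgr := card_finrank_eq_mul_qDescFactorial (k := k) (V := V) r
  rw [hqk, hg] at hgr
  rw [Nat.card_congr e, hcount]
  simp only [← cast_qDescFactorial hq0]
  obtain ⟨a, rfl⟩ := Nat.exists_eq_add_of_le hsr
  obtain ⟨b, rfl⟩ := Nat.exists_eq_add_of_le hrg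
  have hpos (x y : ℕ) (h : y ≤ x) : (qDescFactorial q x y : ℚ) ≠ 0 := by
    rw [Nat.cast_ne_zero]
    refine Finset.prod_ne_zero_iff.2 fun i hi ↦ ?_
    have := Nat.pow_lt_pow_right hq1 ((Finset.mem_range.1 hi).trans_le h)
    omega
  rw [add_assoc s a b, qDescFactorial_add, qDescFactorial_add, mul_left_comm (qDescFactorial q _ s),
    mul_left_comm (qDescFactorial q _ s), mul_left_comm _ (q ^ _)] at hgr
  replace hgr := Nat.eq_of_mul_eq_mul_left (pow_pos hq0 _) hgr
  rw [add_assoc s a b, Nat.add_sub_cancel_left, Nat.add_sub_cancel_left]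
  have h0 := hpos a a le_rfl
  replace hgr := congrArg (Nat.cast : ℕ → ℚ) hgr
  push_cast at hgr ⊢
  field_simp
  linear_combination (qDescFactorial q (a + b - 1) a : ℚ) * hgr
end

section
/- Let k be a finite field, τ a field automorphism of k, V a k-vector space of dimension g, and r, s nonnegative integers with s ≤ r ≤ g. Then the set P_{r,s}^τ := { F a τ-semilinear endomorphism of V : rk(F) = r and rk_∞(F) = s } is in bijection with (in particular has the same cardinality as) the set X_{r,s} of g-tuples (x_1, …, x_g) ∈ V^g satisfying: (1) dim Span{x_1, …, x_g} = r; (2) dim Span{x_{g-s+1}, …, x_g} = s; and (3) x_{g-s} ∈ Span{x_{g-s+1}, …, x_g}. -/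
open Module in
/-- A decreasing sequence of subspaces starting at the whole space admits linearly independent
families adapted to it, of every length up to the dimension. -/
theorem exists_linearIndependent_adapted {k V : Type*} [Field k] [AddCommGroup V] [Module k V]
    [FiniteDimensional k V] (U : ℕ → Submodule k V) (hU : Antitone U) (h0 : U 0 = ⊤) (n : ℕ)
    (hn : n ≤ finrank k V) :
    ∃ v : Fin n → V, LinearIndependent k v ∧
      ∀ (j : ℕ) (i : Fin n), (i : ℕ) < finrank k (U j) → v i ∈ U j := by
  induction n with
  | zero => exact ⟨Fin.elim0, linearIndependent_empty_type, fun _ i => i.elim0⟩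
  | succ n ih =>
    obtain ⟨v, hv, hvU⟩ := ih (by omega)
    have hsub : ∃ W : Submodule k V, n < finrank k W ∧
        ∀ j, n < finrank k (U j) → W ≤ U j := by
      by_cases h : ∀ j, n < finrank k (U j)
      · obtain ⟨N, hN⟩ := IsArtinian.monotone_stabilizes (R := k) (M := V)
          ⟨fun j => OrderDual.toDual (U j), fun a b hab => hU hab⟩
        refine ⟨U N, h N, fun j _ => ?_⟩
        rcases le_total N j with hj | hj
        · exact le_of_eq (hN j hj)
        · exact hU hj
      · push Not at h
        classical
        have hpos : Nat.find h ≠ 0 := by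
          intro h'
          have := Nat.find_spec h
          rw [h', h0, finrank_top] at this
          omega
        refine ⟨U (Nat.find h - 1), ?_, fun j hj => hU ?_⟩
        · exact not_le.1 (Nat.find_min h (by omega))
        · by_contra! hlt
          have h1 := Submodule.finrank_mono (hU (show Nat.find h ≤ j by omega))
          have h2 := Nat.find_spec h
          omega
    obtain ⟨W, hW, hWU⟩ := hsub
    obtain ⟨w, hwW, hwv⟩ : ∃ w ∈ W, w ∉ Submodule.span k (Set.range v) := by
      by_contra! hall
      have h1 := Submodule.finrank_mono (show W ≤ _ from hall)
      rw [finrank_span_eq_card hv, Fintype.card_fin] at h1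
      omega
    refine ⟨Fin.snoc v w, linearIndependent_finSnoc.2 ⟨hv, hwv⟩, fun j i => ?_⟩
    refine Fin.lastCases (fun hi => ?_) (fun i hi => ?_) i
    · rw [Fin.snoc_last]
      exact hWU j (by simpa using hi) hwW
    · rw [Fin.snoc_castSucc]
      exact hvU j i (by simpa using hi)

/-- The span of the last `m` entries of a `g`-tuple. -/
def tailSpan (k : Type*) {V : Type*} [Field k] [AddCommGroup V] [Module k V] {g : ℕ}
    (x : Fin g → V) (m : ℕ) : Submodule k V :=
  Submodule.span k (x '' {i : Fin g | g - m ≤ (i : ℕ)})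

section TailSpan

open Module

variable {k V : Type*} [Field k] [AddCommGroup V] [Module k V] {g : ℕ}

theorem tailSpan_mono (x : Fin g → V) : Monotone (tailSpan k x) := by
  intro a b hab
  refine Submodule.span_mono (Set.image_mono fun i hi => ?_)
  simp only [Set.mem_ofPred_eq] at hi ⊢
  omega

theorem tailSpan_of_le (x : Fin g → V) {m : ℕ} (hm : g ≤ m) :
    tailSpan k x m = Submodule.span k (Set.range x) := by
  have : {i : Fin g | g - m ≤ (i : ℕ)} = Set.univ := by
    ext i
    simp only [Set.mem_ofPred_eq, Set.mem_univ, iff_true]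
    omega
  rw [tailSpan, this, Set.image_univ]

theorem tailSpan_succ (x : Fin g → V) {m : ℕ} (j : Fin g) (hj : (j : ℕ) + 1 = g - m) :
    tailSpan k x (m + 1) = tailSpan k x m ⊔ Submodule.span k {x j} := by
  have : {i : Fin g | g - (m + 1) ≤ (i : ℕ)} = {i : Fin g | g - m ≤ (i : ℕ)} ∪ {j} := by
    ext i
    simp only [Set.mem_ofPred_eq, Set.mem_union, Set.mem_singleton_iff, Fin.ext_iff]
    omega
  rw [tailSpan, this, Set.image_union, Submodule.span_union, Set.image_singleton, tailSpan]

theorem map_tailSpan {σ : k →+* k} [RingHomSurjective σ] (f : V →ₛₗ[σ] V) (e : Fin g → V)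
    (m : ℕ) : (tailSpan k e m).map f = tailSpan k (fun i => f (e i)) m := by
  rw [tailSpan, Submodule.map_span, Set.image_image, tailSpan]

variable [FiniteDimensional k V]

theorem finrank_tailSpan_succ_le (x : Fin g → V) (m : ℕ) :
    finrank k (tailSpan k x (m + 1)) ≤ finrank k (tailSpan k x m) + 1 := by
  rcases le_or_gt g m with h | h
  · rw [tailSpan_of_le x h, tailSpan_of_le x (by omega)]
    omega
  · rw [tailSpan_succ x ⟨g - m - 1, by omega⟩ (by simp only; omega)]
    exact (Submodule.finrank_add_le_finrank_add_finrank _ _).trans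
      (Nat.add_le_add_left (by simpa using finrank_span_le_card (R := k) {_}) _)

theorem finrank_tailSpan_add_le (x : Fin g → V) (m n : ℕ) :
    finrank k (tailSpan k x (m + n)) ≤ finrank k (tailSpan k x m) + n := by
  induction n with
  | zero => rfl
  | succ n ih =>
    have := finrank_tailSpan_succ_le (k := k) x (m + n)
    rw [← add_assoc]
    omega

theorem exists_basis_eq_tailSpan (hg : finrank k V = g) (U : ℕ → Submodule k V)
    (hU : Antitone U) (h0 : U 0 = ⊤) :
    ∃ b : Basis (Fin g) k V, ∀ j, U j = tailSpan k b (finrank k (U j)) := by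
  obtain ⟨v, hv, hvU⟩ := exists_linearIndependent_adapted U hU h0 g hg.ge
  have hv' : LinearIndependent k (v ∘ Fin.rev) := hv.comp _ Fin.rev_injective
  refine ⟨basisOfLinearIndependentOfCardEqFinrank' _ hv' (by simp [hg]), fun j => ?_⟩
  rw [coe_basisOfLinearIndependentOfCardEqFinrank']
  symm
  apply Submodule.eq_of_le_of_finrank_le
  · rw [tailSpan, Submodule.span_le]
    rintro _ ⟨i, hi, rfl⟩
    refine hvU j _ ?_
    simp only [Set.mem_ofPred_eq] at hi
    have := Submodule.finrank_le (U j)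
    rw [Fin.val_rev]
    omega
  · have h1 := finrank_tailSpan_add_le (k := k) (v ∘ Fin.rev) (finrank k (U j))
      (g - finrank k (U j))
    have h2 := Submodule.finrank_le (U j)
    rw [tailSpan_of_le _ (by omega), finrank_span_eq_card hv', Fintype.card_fin] at h1
    omega

end TailSpan

/-- The decreasing sequence of subspaces obtained from a tuple `x` by starting with the whole space
and repeatedly taking the span of as many of the last entries of `x` as the current dimension. -/
noncomputable def tupleFlag (k : Type*) {V : Type*} [Field k] [AddCommGroup V] [Module k V] {g : ℕ}
    (x : Fin g → V) : ℕ → Submodule k V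
  | 0 => ⊤
  | n + 1 => tailSpan k x (Module.finrank k (tupleFlag k x n))

/-- The decreasing sequence of images of the iterates of a semilinear endomorphism. -/
def imageFlag {k V : Type*} [Field k] [AddCommGroup V] [Module k V] {σ : k →+* k}
    [RingHomSurjective σ] (f : V →ₛₗ[σ] V) : ℕ → Submodule k V
  | 0 => ⊤
  | n + 1 => (imageFlag f n).map f

section Flags

open Module

variable {k V : Type*} [Field k] [AddCommGroup V] [Module k V] {g : ℕ}

theorem imageFlag_antitone {σ : k →+* k} [RingHomSurjective σ] (f : V →ₛₗ[σ] V) :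
    Antitone (imageFlag f) := by
  refine antitone_nat_of_succ_le fun n => ?_
  induction n with
  | zero => exact le_top
  | succ n ih => exact Submodule.map_mono ih

theorem coe_imageFlag {σ : k →+* k} [RingHomSurjective σ] (f : V →ₛₗ[σ] V) (n : ℕ) :
    (imageFlag f n : Set V) = Set.range (f^[n]) := by
  induction n with
  | zero => simp [imageFlag]
  | succ n ih =>
    rw [imageFlag, Submodule.map_coe, ih, Function.iterate_succ', Set.range_comp]

theorem imageFlag_eq_tupleFlag {σ : k →+* k} [RingHomSurjective σ] (f : V →ₛₗ[σ] V)
    (e : Fin g → V) (he : ∀ j, imageFlag f j = tailSpan k e (finrank k (imageFlag f j))) :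
    imageFlag f = tupleFlag k (fun i => f (e i)) := by
  funext n
  induction n with
  | zero => rfl
  | succ n ih =>
    rw [imageFlag, tupleFlag, ← ih, ← map_tailSpan, ← he]

theorem imageFlag_eq_tupleFlag_of_apply {σ : k →+* k} [RingHomSurjective σ] (f : V →ₛₗ[σ] V)
    (x e : Fin g → V) (hf : ∀ i, f (e i) = x i)
    (he : ∀ j, tupleFlag k x j = tailSpan k e (finrank k (tupleFlag k x j))) :
    imageFlag f = tupleFlag k x := by
  funext n
  induction n with
  | zero => rfl
  | succ n ih =>
    rw [imageFlag, tupleFlag, ih, he n, map_tailSpan, ← he n]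
    simp only [hf]

theorem exists_semilinear_apply_basis (σ : k →+* k) (e : Basis (Fin g) k V) (x : Fin g → V) :
    ∃ f : V →ₛₗ[σ] V, ∀ i, f (e i) = x i := by
  refine ⟨{ toFun := fun v => ∑ i, σ (e.repr v i) • x i
            map_add' := fun v w => by simp [add_smul, Finset.sum_add_distrib]
            map_smul' := fun a v => by simp [mul_smul, Finset.smul_sum] }, fun i => ?_⟩
  change ∑ j, σ (e.repr (e i) j) • x j = x i
  rw [Finset.sum_eq_single i]
  · simp
  · intro j _ hj
    simp [Finsupp.single_eq_of_ne hj]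
  · simp

variable [FiniteDimensional k V]

theorem tupleFlag_antitone (x : Fin g → V) : Antitone (tupleFlag k x) := by
  refine antitone_nat_of_succ_le fun n => ?_
  induction n with
  | zero => exact le_top
  | succ n ih => exact tailSpan_mono x (Submodule.finrank_mono ih)

theorem tailSpan_le_tupleFlag (x : Fin g → V) {m : ℕ} (hm : m ≤ finrank k (tailSpan k x m))
    (n : ℕ) : tailSpan k x m ≤ tupleFlag k x n := by
  induction n with
  | zero => exact le_top
  | succ n ih => exact tailSpan_mono x (hm.trans (Submodule.finrank_mono ih))

theorem exists_iInf_tupleFlag_eq (x : Fin g → V) : ∃ n, ⨅ j, tupleFlag k x j = tupleFlag k x n ∧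
    tupleFlag k x n = tupleFlag k x (n + 1) := by
  obtain ⟨N, hN⟩ := IsArtinian.monotone_stabilizes (R := k) (M := V)
    ⟨fun j => OrderDual.toDual (tupleFlag k x j), fun a b hab => tupleFlag_antitone x hab⟩
  refine ⟨N, le_antisymm (iInf_le _ _) (le_iInf fun j => ?_), hN (N + 1) (by omega)⟩
  rcases le_total N j with hj | hj
  · exact le_of_eq (hN j hj)
  · exact tupleFlag_antitone x hj

theorem finrank_iInf_tupleFlag_eq_iff (x : Fin g → V) (s : ℕ) :
    finrank k (⨅ j, tupleFlag k x j : Submodule k V) = s ↔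
      finrank k (tailSpan k x s) = s ∧
        ∀ j : Fin g, (j : ℕ) + 1 = g - s → x j ∈ tailSpan k x s := by
  obtain ⟨n, hn, hn'⟩ := exists_iInf_tupleFlag_eq (k := k) x
  rw [hn]
  rw [tupleFlag] at hn'
  constructor
  · rintro rfl
    rw [← hn']
    refine ⟨rfl, fun j hj => ?_⟩
    set m := finrank k (tupleFlag k x n) with hm
    by_contra hx
    have hlt : tailSpan k x m < tailSpan k x (m + 1) := by
      refine lt_of_le_of_ne (tailSpan_mono x (by omega)) fun h => hx ?_
      rw [hn', h, tailSpan_succ x j hj]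
      exact Submodule.mem_sup_right (Submodule.mem_span_singleton_self _)
    have h1 : m + 1 ≤ finrank k (tailSpan k x (m + 1)) := by
      have := Submodule.finrank_lt_finrank_of_lt hlt
      rwa [← hn', ← hm] at this
    have h2 := Submodule.finrank_mono (tailSpan_le_tupleFlag x h1 n)
    omega
  · rintro ⟨hs, hx⟩
    have h1 := Submodule.finrank_mono (tailSpan_le_tupleFlag x hs.ge n)
    rw [hs] at h1
    by_contra hne
    have hsucc : tailSpan k x (s + 1) = tailSpan k x s := by
      rcases le_or_gt g s with h | h
      · rw [tailSpan_of_le x h, tailSpan_of_le x (by omega)]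
      · have hj : ((⟨g - s - 1, by omega⟩ : Fin g) : ℕ) + 1 = g - s := by simp only; omega
        rw [tailSpan_succ x _ hj, sup_eq_left, Submodule.span_singleton_le_iff_mem]
        exact hx _ hj
    have h2 := finrank_tailSpan_add_le (k := k) x (s + 1) (finrank k (tupleFlag k x n) - (s + 1))
    rw [hsucc, hs, show s + 1 + (finrank k (tupleFlag k x n) - (s + 1)) =
      finrank k (tupleFlag k x n) by omega, ← hn'] at h2
    omega

/-- Semilinear endomorphisms of a `g`-dimensional space correspond to `g`-tuples of vectors, in such
a way that the image is the span of the tuple and the flags of iterated images agree. -/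
theorem exists_bijective_imageFlag_eq (hg : finrank k V = g) (σ : k →+* k) [RingHomSurjective σ] :
    ∃ Φ : (V →ₛₗ[σ] V) → (Fin g → V), Function.Bijective Φ ∧ ∀ f,
      imageFlag f = tupleFlag k (Φ f) ∧ LinearMap.range f = Submodule.span k (Set.range (Φ f)) := by
  have hex : ∀ U : ℕ → Submodule k V, ∃ b : Basis (Fin g) k V, Antitone U → U 0 = ⊤ →
      ∀ j, U j = tailSpan k b (finrank k (U j)) := by
    intro U
    by_cases h : Antitone U ∧ U 0 = ⊤
    · obtain ⟨b, hb⟩ := exists_basis_eq_tailSpan hg U h.1 h.2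
      exact ⟨b, fun _ _ => hb⟩
    · exact ⟨finBasisOfFinrankEq k V hg, fun h1 h2 => absurd ⟨h1, h2⟩ h⟩
  choose E hE using hex
  have hflag : ∀ f : V →ₛₗ[σ] V,
      imageFlag f = tupleFlag k (fun i => f (E (imageFlag f) i)) := fun f =>
    imageFlag_eq_tupleFlag f _ (hE _ (imageFlag_antitone f) rfl)
  refine ⟨fun f i => f (E (imageFlag f) i), ⟨fun f f' hff => ?_, fun x => ?_⟩,
    fun f => ⟨hflag f, ?_⟩⟩
  · have hU : imageFlag f = imageFlag f' := by
      rw [hflag f, hflag f']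
      exact congrArg _ hff
    refine (E (imageFlag f)).ext fun i => ?_
    have := congrFun hff i
    simp only [← hU] at this
    exact this
  · obtain ⟨f, hf⟩ := exists_semilinear_apply_basis σ (E (tupleFlag k x)) x
    refine ⟨f, funext fun i => ?_⟩
    simp only [imageFlag_eq_tupleFlag_of_apply f x _ hf (hE _ (tupleFlag_antitone x) rfl), hf]
  · rw [LinearMap.range_eq_map, ← (E (imageFlag f)).span_eq, Submodule.map_span,
      ← Set.range_comp]
    rfl

end Flags


/-- Lemma 3.2: the set P_{r,s}^τ of τ-semilinear endomorphisms of rank r and infinity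
rank s is in bijection with the set X_{r,s} of g-tuples (x_1,…,x_g) (0-indexed) with
dim span{x_1,…,x_g} = r, dim span{x_{g-s+1},…,x_g} = s, and
x_{g-s} ∈ span{x_{g-s+1},…,x_g}. -/
theorem semilinear_tuples_bijection
    {k V : Type*} [Field k] [Fintype k] [AddCommGroup V] [Module k V]
    [FiniteDimensional k V]
    (g r s : ℕ) (hg : Module.finrank k V = g) (τ : k ≃+* k)
    (hsr : s ≤ r) (hrg : r ≤ g) :
    ∃ φ : {F : V →+ V // (∀ (a : k) (v : V), F (a • v) = τ a • F v) ∧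
            Module.finrank k (Submodule.span k (Set.range F)) = r ∧
            Module.finrank k (Submodule.span k (⋂ n : ℕ, Set.range ((⇑F)^[n]))) = s} →
          {x : Fin g → V //
            Module.finrank k (Submodule.span k (Set.range x)) = r ∧
            Module.finrank k (Submodule.span k (x '' {i : Fin g | g - s ≤ (i : ℕ)})) = s ∧
            ∀ j : Fin g, (j : ℕ) + 1 = g - s →
              x j ∈ Submodule.span k (x '' {i : Fin g | g - s ≤ (i : ℕ)})},
      Function.Bijective φ := by
  obtain ⟨Φ, hΦ, hflag⟩ := exists_bijective_imageFlag_eq hg (τ : k →+* k)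
  have hrank : ∀ f : V →ₛₗ[(τ : k →+* k)] V,
      Submodule.span k (Set.range f) = Submodule.span k (Set.range (Φ f)) := fun f => by
    rw [← (hflag f).2, ← LinearMap.coe_range, Submodule.span_eq]
  have hinf : ∀ f : V →ₛₗ[(τ : k →+* k)] V,
      Submodule.span k (⋂ n : ℕ, Set.range ((⇑f)^[n])) = ⨅ j, tupleFlag k (Φ f) j := fun f => by
    simp only [← coe_imageFlag, ← Submodule.coe_iInf, Submodule.span_eq, (hflag f).1]
  refine ⟨fun F => ⟨Φ { F.1 with map_smul' := F.2.1 }, ?_, ?_⟩, ?_, ?_⟩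
  · rw [← hrank]
    exact F.2.2.1
  · refine (finrank_iInf_tupleFlag_eq_iff _ s).1 ?_
    rw [← hinf]
    exact F.2.2.2
  · rintro ⟨F, hF⟩ ⟨F', hF'⟩ h
    have h' := hΦ.1 (Subtype.ext_iff.1 h)
    exact Subtype.ext (AddMonoidHom.ext fun v => LinearMap.congr_fun h' v)
  · rintro ⟨x, hx⟩
    obtain ⟨f, rfl⟩ := hΦ.2 x
    refine ⟨⟨f.toAddMonoidHom, fun a v => f.map_smulₛₗ a v, ?_, ?_⟩, rfl⟩
    · exact (congrArg (fun W : Submodule k V => Module.finrank k W) (hrank f)).trans hx.1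
    · exact (congrArg (fun W : Submodule k V => Module.finrank k W) (hinf f)).trans
        ((finrank_iInf_tupleFlag_eq_iff _ s).2 hx.2)
end

section
/- Let k be a finite field, V a k-vector space of dimension g, and r, s nonnegative integers with s ≤ r ≤ g. For any two field automorphisms τ and τ′ of k, the number of τ-semilinear endomorphisms F of V with rk(F) = r and rk_∞(F) = s equals the number of τ′-semilinear endomorphisms F of V with rk(F) = r and rk_∞(F) = s. -/
/-- A monotone chain of subspaces admits, up to any given level, a linearly independent set
whose intersection with each member of the chain spans that member. -/
theorem exists_linearIndepOn_adapted_of_monotone {k V : Type*} [Field k] [AddCommGroup V]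
    [Module k V] {W : ℕ → Submodule k V} (hW : Monotone W) (j : ℕ) :
    ∃ B : Set V, B ⊆ W j ∧ LinearIndepOn k id B ∧
      ∀ i ≤ j, W i ≤ Submodule.span k (B ∩ W i) := by
  induction j with
  | zero =>
    obtain ⟨B, hB, -, hspan, hli⟩ := exists_linearIndepOn_id_extension
      (linearIndepOn_empty k (id : V → V)) (Set.empty_subset (W 0 : Set V))
    refine ⟨B, hB, hli, fun i hi => ?_⟩
    obtain rfl : i = 0 := by omega
    rw [Set.inter_eq_left.mpr hB]
    exact hspan
  | succ j ih =>
    obtain ⟨B, hB, hli, hadapted⟩ := ih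
    obtain ⟨C, hC, hBC, hspan, hCli⟩ := exists_linearIndepOn_id_extension hli
      (hB.trans (hW j.le_succ : (W j : Set V) ⊆ W (j + 1)))
    refine ⟨C, hC, hCli, fun i hi => ?_⟩
    rcases Nat.le_succ_iff.mp hi with hi | rfl
    · exact (hadapted i hi).trans (Submodule.span_mono (Set.inter_subset_inter_left _ hBC))
    · rw [Set.inter_eq_left.mpr hC]
      exact hspan

/-- A semilinear map fixing a set pointwise preserves its span. -/
theorem AddMonoidHom.map_mem_span_of_fixed {k V : Type*} [Field k] [AddCommGroup V] [Module k V]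
    {ρ : k ≃+* k} {f : V →+ V} (hf : ∀ (a : k) (v : V), f (a • v) = ρ a • f v)
    {S : Set V} (hS : ∀ v ∈ S, f v = v) {v : V} (hv : v ∈ Submodule.span k S) :
    f v ∈ Submodule.span k S := by
  induction hv using Submodule.span_induction with
  | mem x hx => exact (hS x hx).symm ▸ Submodule.subset_span hx
  | zero => simp
  | add x y _ _ hx hy => exact map_add f x y ▸ Submodule.add_mem _ hx hy
  | smul a x _ hx => exact hf a x ▸ Submodule.smul_mem _ _ hx

/-- Coordinatewise application of a field automorphism is a semilinear automorphism that fixes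
the basis vectors. -/
theorem Module.Basis.exists_semilinear_addEquiv {k V ι : Type*} [Field k] [AddCommGroup V]
    [Module k V] (b : Module.Basis ι k V) (ρ : k ≃+* k) :
    ∃ ψ : V ≃+ V, (∀ (a : k) (v : V), ψ (a • v) = ρ a • ψ v) ∧ ∀ i, ψ (b i) = b i := by
  refine ⟨(b.repr.toAddEquiv.trans (Finsupp.mapRange.addEquiv ρ.toAddEquiv)).trans
    b.repr.symm.toAddEquiv, fun a v => ?_, fun i => ?_⟩
  · apply b.repr.injective
    ext i
    simp
  · apply b.repr.injective
    ext j
    by_cases h : i = j <;> simp [h]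

/-- Every field automorphism lifts to a semilinear automorphism stabilizing a given descending
chain of subspaces. -/
theorem exists_semilinear_addEquiv_image_eq {k V : Type*} [Field k] [AddCommGroup V]
    [Module k V] [FiniteDimensional k V] (ρ : k ≃+* k) {U : ℕ → Submodule k V}
    (hU : Antitone U) (hU₀ : U 0 = ⊤) :
    ∃ ψ : V ≃+ V, (∀ (a : k) (v : V), ψ (a • v) = ρ a • ψ v) ∧
      ∀ n, ψ '' (U n : Set V) = U n := by
  obtain ⟨m, hm⟩ := IsArtinian.monotone_stabilizes (R := k) (M := V)
    ⟨fun n => OrderDual.toDual (U n), fun _ _ h => hU h⟩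
  obtain ⟨B, -, hli, hadapted⟩ := exists_linearIndepOn_adapted_of_monotone
    (W := fun j => U (m - j)) (fun _ _ h => hU (Nat.sub_le_sub_left h m)) m
  have hspan (n : ℕ) : U n = Submodule.span k (B ∩ U n) := by
    refine le_antisymm ?_ (Submodule.span_le.mpr Set.inter_subset_right)
    rcases le_total n m with hn | hn
    · simpa [Nat.sub_sub_self hn] using hadapted (m - n) (Nat.sub_le m n)
    · have h : U m = U n := hm n hn
      simpa [h] using hadapted 0 m.zero_le
  have htop : ⊤ ≤ Submodule.span k (Set.range fun x : B => (x : V)) := by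
    rw [Subtype.range_coe, ← hU₀, hspan 0]
    exact Submodule.span_mono Set.inter_subset_left
  have hli' : LinearIndependent k fun x : B => (x : V) := hli
  obtain ⟨ψ, hψ, hfix⟩ :=
    (Module.Basis.mk hli' htop).exists_semilinear_addEquiv ρ
  have hfix' (x : V) (hx : x ∈ B) : ψ x = x := by
    simpa only [Module.Basis.mk_apply] using hfix ⟨x, hx⟩
  have hψsymm (a : k) (v : V) : ψ.symm (a • v) = ρ.symm a • ψ.symm v := by
    apply ψ.injective
    simp [hψ]
  refine ⟨ψ, hψ, fun n => Set.Subset.antisymm ?_ fun v hv => ⟨ψ.symm v, ?_, by simp⟩⟩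
  · rintro _ ⟨v, hv, rfl⟩
    rw [hspan n] at hv ⊢
    exact AddMonoidHom.map_mem_span_of_fixed (f := ψ.toAddMonoidHom) hψ
      (fun x hx => hfix' x hx.1) hv
  · rw [hspan n] at hv ⊢
    exact AddMonoidHom.map_mem_span_of_fixed (f := ψ.symm.toAddMonoidHom) hψsymm
      (fun x hx => ψ.symm_apply_eq.mpr (hfix' x hx.1).symm) hv

/-- The images of the iterates of a semilinear endomorphism form a descending chain of
subspaces. -/
theorem AddMonoidHom.exists_antitone_submodule_eq_range_iterate {k V : Type*} [Field k]
    [AddCommGroup V] [Module k V] {τ : k ≃+* k} {F : V →+ V}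
    (hF : ∀ (a : k) (v : V), F (a • v) = τ a • F v) :
    ∃ U : ℕ → Submodule k V, Antitone U ∧ U 0 = ⊤ ∧ ∀ n, (U n : Set V) = Set.range F^[n] := by
  have hsmul (n : ℕ) : ∀ a : k, ∃ b : k, ∀ v : V, F^[n] (b • v) = a • F^[n] v := by
    induction n with
    | zero => exact fun a => ⟨a, fun _ => rfl⟩
    | succ n ih =>
      intro a
      obtain ⟨b, hb⟩ := ih (τ.symm a)
      exact ⟨b, fun v => by
        rw [Function.iterate_succ_apply', hb, hF, τ.apply_symm_apply, Function.iterate_succ_apply']⟩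
  refine ⟨fun n =>
    { carrier := Set.range F^[n]
      zero_mem' := ⟨0, iterate_map_zero F n⟩
      add_mem' := by
        rintro _ _ ⟨v, rfl⟩ ⟨w, rfl⟩
        exact ⟨v + w, iterate_map_add F n v w⟩
      smul_mem' := by
        rintro a _ ⟨v, rfl⟩
        obtain ⟨b, hb⟩ := hsmul n a
        exact ⟨b • v, hb v⟩ }, antitone_nat_of_succ_le fun n => ?_, ?_, fun n => rfl⟩
  · rintro _ ⟨v, rfl⟩
    exact ⟨F v, rfl⟩
  · exact SetLike.coe_injective (by simp)

/-- Precomposing with a bijection that stabilizes the images of all iterates does not change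
these images. -/
theorem Set.range_iterate_comp_of_image_eq {α : Type*} {f ψ : α → α}
    (h : ∀ n, ψ '' Set.range f^[n] = Set.range f^[n]) (n : ℕ) :
    Set.range (f ∘ ψ)^[n] = Set.range f^[n] := by
  induction n with
  | zero => rfl
  | succ n ih =>
    rw [Function.iterate_succ', Set.range_comp, ih, Set.image_comp, h, ← Set.range_comp,
      ← Function.iterate_succ']

/-- For a property `P` of the sequence of images of iterates, there are at most as many
`τ`-semilinear as `τ'`-semilinear endomorphisms satisfying it. -/
theorem card_semilinear_le_of_range_iterate {k V : Type*} [Field k] [Finite k] [AddCommGroup V]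
    [Module k V] [FiniteDimensional k V] (τ τ' : k ≃+* k) (P : (ℕ → Set V) → Prop) :
    Nat.card {F : V →+ V // (∀ (a : k) (v : V), F (a • v) = τ a • F v) ∧
        P fun n => Set.range F^[n]} ≤
      Nat.card {F : V →+ V // (∀ (a : k) (v : V), F (a • v) = τ' a • F v) ∧
        P fun n => Set.range F^[n]} := by
  have : Finite V := Module.finite_of_finite k
  have : Finite (V →+ V) := DFunLike.finite _
  have hlift (t : ℕ → Set V) (ht : ∃ F : V →+ V, (∀ (a : k) (v : V), F (a • v) = τ a • F v) ∧
      (fun n => Set.range F^[n]) = t) :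
      ∃ ψ : V ≃+ V, (∀ (a : k) (v : V), ψ (a • v) = (τ'.trans τ.symm) a • ψ v) ∧
        ∀ n, ψ '' t n = t n := by
    obtain ⟨F, hF, rfl⟩ := ht
    obtain ⟨U, hU, hU₀, hUF⟩ := AddMonoidHom.exists_antitone_submodule_eq_range_iterate hF
    simpa only [hUF] using exists_semilinear_addEquiv_image_eq (τ'.trans τ.symm) hU hU₀
  choose! ψ hψ hψt using hlift
  have hflag (F : V →+ V) (hF : ∀ (a : k) (v : V), F (a • v) = τ a • F v) :
      (fun n => Set.range (F.comp (ψ fun n => Set.range F^[n]).toAddMonoidHom)^[n]) =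
        fun n => Set.range F^[n] :=
    funext (Set.range_iterate_comp_of_image_eq (hψt _ ⟨F, hF, rfl⟩))
  refine Nat.card_le_card_of_injective
    (fun F => ⟨F.1.comp (ψ fun n => Set.range F.1^[n]).toAddMonoidHom, fun a v => ?_, ?_⟩) ?_
  · simp [hψ _ ⟨F.1, F.2.1, rfl⟩, F.2.1]
  · rw [hflag F.1 F.2.1]
    exact F.2.2
  · rintro ⟨F, hF, _⟩ ⟨G, hG, _⟩ hFG
    have hcomp := congrArg Subtype.val hFG
    have ht := hflag F hF
    simp only at hcomp
    rw [hcomp, hflag G hG] at ht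
    rw [ht] at hcomp
    refine Subtype.ext (AddMonoidHom.ext fun v => ?_)
    simpa using DFunLike.congr_fun hcomp ((ψ fun n => Set.range F^[n]).symm v)

/-- The number of τ-semilinear endomorphisms of rank r and infinity rank s does not
depend on the automorphism τ. -/
theorem count_semilinear_independent_of_automorphism
    {k V : Type*} [Field k] [Fintype k] [AddCommGroup V] [Module k V]
    [FiniteDimensional k V]
    (g r s : ℕ) (hg : Module.finrank k V = g) (τ τ' : k ≃+* k)
    (hsr : s ≤ r) (hrg : r ≤ g) :
    Nat.card {F : V →+ V // (∀ (a : k) (v : V), F (a • v) = τ a • F v) ∧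
        Module.finrank k (Submodule.span k (Set.range F)) = r ∧
        Module.finrank k (Submodule.span k (⋂ n : ℕ, Set.range ((⇑F)^[n]))) = s} =
    Nat.card {F : V →+ V // (∀ (a : k) (v : V), F (a • v) = τ' a • F v) ∧
        Module.finrank k (Submodule.span k (Set.range F)) = r ∧
        Module.finrank k (Submodule.span k (⋂ n : ℕ, Set.range ((⇑F)^[n]))) = s} := by
  have h := fun σ σ' : k ≃+* k => card_semilinear_le_of_range_iterate (V := V) σ σ' fun t =>
    Module.finrank k (Submodule.span k (t 1)) = r ∧
      Module.finrank k (Submodule.span k (⋂ n : ℕ, t n)) = s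
  exact le_antisymm (h τ τ') (h τ' τ)
end

section
/- Let k be a finite field of order q, τ a field automorphism of k, and V a k-vector space of dimension g ≥ 1. The number of nilpotent τ-semilinear endomorphisms of V (equivalently, those F with F^g = 0, equivalently those with rk_∞(F) = 0) equals q^{g² − g}. -/
section SemilinearNilpotent

open Module

variable {k V : Type*} [Field k] [AddCommGroup V] [Module k V] {σ : k →+* k}

/-- The subspace of vectors sent into `W` by the `n`-th iterate of `F`. -/
def iterComap (F : V →ₛₗ[σ] V) (W : Submodule k V) : ℕ → Submodule k V
  | 0 => W
  | n + 1 => (iterComap F W n).comap F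

theorem mem_iterComap {F : V →ₛₗ[σ] V} {W : Submodule k V} {n : ℕ} {v : V} :
    v ∈ iterComap F W n ↔ F^[n] v ∈ W := by
  induction n generalizing v with
  | zero => rfl
  | succ n ih => exact ih (v := F v)

theorem iterate_mem_of_le {F : V →ₛₗ[σ] V} {W : Submodule k V} (hW : W ≤ W.comap F)
    {i j : ℕ} (hij : i ≤ j) {v : V} (h : F^[i] v ∈ W) : F^[j] v ∈ W := by
  induction hij with
  | refl => exact h
  | step _ ih => rw [Function.iterate_succ_apply']; exact hW ih

theorem iterComap_mono {F : V →ₛₗ[σ] V} {W : Submodule k V} (hW : W ≤ W.comap F) :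
    Monotone (iterComap F W) := fun _ _ hij _ hv ↦
  mem_iterComap.2 (iterate_mem_of_le hW hij (mem_iterComap.1 hv))

/-- The subspace of vectors killed by some iterate of `F`. -/
def nilSubspace (F : V →ₛₗ[σ] V) : Submodule k V where
  carrier := {v | ∃ n, F^[n] v = 0}
  zero_mem' := ⟨0, rfl⟩
  add_mem' := by
    have hbot : (⊥ : Submodule k V) ≤ (⊥ : Submodule k V).comap F := bot_le
    rintro a b ⟨i, hi⟩ ⟨j, hj⟩
    refine ⟨max i j, ?_⟩
    have ha : a ∈ iterComap F ⊥ (max i j) :=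
      iterComap_mono hbot (le_max_left i j) (mem_iterComap.2 hi)
    have hb : b ∈ iterComap F ⊥ (max i j) :=
      iterComap_mono hbot (le_max_right i j) (mem_iterComap.2 hj)
    exact mem_iterComap.1 (add_mem ha hb)
  smul_mem' := by
    rintro c v ⟨n, hn⟩
    exact ⟨n, mem_iterComap.1 (Submodule.smul_mem (iterComap F ⊥ n) c (mem_iterComap.2 hn))⟩

theorem mem_nilSubspace_of_apply {F : V →ₛₗ[σ] V} {v : V} (h : F v ∈ nilSubspace F) :
    v ∈ nilSubspace F := by
  obtain ⟨n, hn⟩ := h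
  exact ⟨n + 1, hn⟩

/-- The span of `W` and the first `m` terms of the sequence `u`. -/
def chainSpan (W : Submodule k V) (u : ℕ → V) (m : ℕ) : Submodule k V :=
  W ⊔ Submodule.span k (u '' Set.Iio m)

theorem le_chainSpan (W : Submodule k V) (u : ℕ → V) (m : ℕ) : W ≤ chainSpan W u m :=
  le_sup_left

theorem mem_chainSpan (W : Submodule k V) (u : ℕ → V) {i m : ℕ} (h : i < m) :
    u i ∈ chainSpan W u m :=
  le_sup_right (a := W) (Submodule.subset_span ⟨i, h, rfl⟩)

theorem chainSpan_zero (W : Submodule k V) (u : ℕ → V) : chainSpan W u 0 = W := by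
  simp [chainSpan]

theorem chainSpan_succ (W : Submodule k V) (u : ℕ → V) (m : ℕ) :
    chainSpan W u (m + 1) = chainSpan W u m ⊔ Submodule.span k {u m} := by
  have : Set.Iio (m + 1) = insert m (Set.Iio m) := by ext; grind
  rw [chainSpan, this, Set.image_insert_eq, Submodule.span_insert, chainSpan, sup_assoc,
    sup_comm (Submodule.span k {u m})]

theorem chainSpan_le {W P : Submodule k V} {u : ℕ → V} {m : ℕ} (hW : W ≤ P)
    (hu : ∀ i < m, u i ∈ P) : chainSpan W u m ≤ P := by
  refine sup_le hW (Submodule.span_le.2 ?_)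
  rintro _ ⟨i, hi, rfl⟩
  exact hu i hi

theorem chainSpan_congr (W : Submodule k V) {u u' : ℕ → V} {m : ℕ}
    (h : ∀ i < m, u i = u' i) : chainSpan W u m = chainSpan W u' m :=
  le_antisymm
    (chainSpan_le (le_chainSpan ..) fun i hi ↦ h i hi ▸ mem_chainSpan W u' hi)
    (chainSpan_le (le_chainSpan ..) fun i hi ↦ h i hi ▸ mem_chainSpan W u hi)

/-- If the orbit of `e` under `F` eventually enters the invariant subspace `W`, it does so as
soon as it becomes linearly dependent modulo `W`. -/
theorem iterate_mem_of_mem_chainSpan {F : V →ₛₗ[σ] V} {W : Submodule k V}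
    (hW : W ≤ W.comap F) {e : V} (he : ∃ s, F^[s] e ∈ W) {m : ℕ}
    (hm : F^[m] e ∈ chainSpan W (fun i ↦ F^[i] e) m) : F^[m] e ∈ W := by
  classical
  obtain ⟨t, ht, hmin⟩ : ∃ t, F^[t] e ∈ W ∧ ∀ s < t, F^[s] e ∉ W :=
    ⟨Nat.find he, Nat.find_spec he, fun s hs ↦ Nat.find_min he hs⟩
  by_contra hmW
  have hmt : m < t := by
    by_contra! h
    exact hmW (iterate_mem_of_le hW h ht)
  have key : ∀ j ≤ m, F^[m] e ∈ W ⊔ Submodule.span k ((fun i ↦ F^[i] e) '' Set.Ico j m) := by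
    intro j
    induction j with
    | zero =>
      intro _
      have : Set.Ico 0 m = Set.Iio m := by ext; simp
      rw [this]; exact hm
    | succ j ih =>
      intro hj
      have h := ih (by omega)
      have hI : Set.Ico j m = insert j (Set.Ico (j + 1) m) := by ext; simp; omega
      rw [hI, Set.image_insert_eq, Submodule.span_insert, sup_left_comm] at h
      obtain ⟨a, ha, z, hz, haz⟩ := Submodule.mem_sup.1 h
      obtain ⟨c, rfl⟩ := Submodule.mem_span_singleton.1 ha
      by_cases hc : c = 0
      · rw [← haz, hc, zero_smul, zero_add]; exact hz
      exfalso
      have horb : ∀ i, j < i → F^[i] e ∈ iterComap F W (t - 1 - j) := fun i hi ↦ by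
        rw [mem_iterComap, ← Function.iterate_add_apply]
        exact iterate_mem_of_le hW (by omega) ht
      have hzK : z ∈ iterComap F W (t - 1 - j) := by
        refine (sup_le (iterComap_mono hW (Nat.zero_le _)) (Submodule.span_le.2 ?_)) hz
        rintro _ ⟨i, hi, rfl⟩
        exact horb i hi.1
      have hK : c • F^[j] e ∈ iterComap F W (t - 1 - j) := by
        rw [eq_sub_of_add_eq haz]
        exact sub_mem (horb m hj) hzK
      rw [Submodule.smul_mem_iff _ hc, mem_iterComap, ← Function.iterate_add_apply] at hK
      exact hmin _ (by omega) hK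
  have := key m le_rfl
  rw [Set.Ico_self, Set.image_empty, Submodule.span_empty, sup_bot_eq] at this
  exact hmW this

theorem iterate_finrank_eq_zero [FiniteDimensional k V] {F : V →ₛₗ[σ] V} {v : V}
    (hv : v ∈ nilSubspace F) : F^[finrank k V] v = 0 := by
  have hbot : (⊥ : Submodule k V) ≤ (⊥ : Submodule k V).comap F := bot_le
  by_contra hne
  have hdim : ∀ m ≤ finrank k V + 1,
      finrank k (chainSpan (⊥ : Submodule k V) (fun i ↦ F^[i] v) m) = m := by
    intro m
    induction m with
    | zero => intro _; rw [chainSpan_zero, finrank_bot]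
    | succ m ih =>
      intro hm
      rw [chainSpan_succ, Submodule.finrank_sup_span_singleton, ih (by omega)]
      intro hmem
      exact hne (iterate_mem_of_le hbot (by omega)
        (iterate_mem_of_mem_chainSpan hbot hv hmem))
  have := hdim _ le_rfl
  have := Submodule.finrank_le (chainSpan (⊥ : Submodule k V) (fun i ↦ F^[i] v) (finrank k V + 1))
  omega

/-- A semilinear map can be modified at a vector outside a subspace, without changing it there. -/
theorem exists_semilinear_eqOn_apply_eq (F₀ : V →ₛₗ[σ] V) {D : Submodule k V} {x : V}
    (hx : x ∉ D) (y : V) :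
    ∃ F : V →ₛₗ[σ] V, (∀ v ∈ D, F v = F₀ v) ∧ F x = y := by
  obtain ⟨f, hfx, hfD⟩ := Submodule.exists_le_ker_of_notMem hx
  refine ⟨{ toFun := fun v ↦ F₀ v + σ ((f x)⁻¹ * f v) • (y - F₀ x)
            map_add' := fun a b ↦ by simp only [map_add, mul_add, add_smul]; abel
            map_smul' := fun c a ↦ by
              simp only [map_smulₛₗ, smul_add, smul_smul, smul_eq_mul, map_mul, RingHom.id_apply]
              congr 2; ring }, fun v hv ↦ ?_, ?_⟩
  · have : f v = 0 := hfD hv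
    simp [this]
  · simp [hfx]

/-- The nilpotent semilinear maps that agree with `F₀` on `D`. -/
abbrev NilExtension (D : Submodule k V) (F₀ : V →ₛₗ[σ] V) : Type _ :=
  {F : V →ₛₗ[σ] V // nilSubspace F = ⊤ ∧ ∀ v ∈ D, F v = F₀ v}

theorem card_nilExtension_congr (D : Submodule k V) {F₀ F₁ : V →ₛₗ[σ] V}
    (h : ∀ v ∈ D, F₁ v = F₀ v) :
    Nat.card (NilExtension D F₀) = Nat.card (NilExtension D F₁) :=
  Nat.card_congr (Equiv.subtypeEquivRight fun F ↦ and_congr_right fun _ ↦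
    forall₂_congr fun v hv ↦ by rw [h v hv])

theorem card_nilExtension_top {F₀ : V →ₛₗ[σ] V} (h : nilSubspace F₀ = ⊤) :
    Nat.card (NilExtension ⊤ F₀) = 1 := by
  rw [Nat.card_eq_one_iff_unique]
  exact ⟨⟨fun a b ↦ Subtype.ext (LinearMap.ext fun v ↦
    (a.2.2 v trivial).trans (b.2.2 v trivial).symm)⟩, ⟨⟨F₀, h, fun _ _ ↦ rfl⟩⟩⟩

theorem finite_semilinear [Finite V] : Finite (V →ₛₗ[σ] V) :=
  DFunLike.finite _

/-- Counting the extensions from `D` by the value taken at a vector `x` outside `D`. -/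
theorem card_nilExtension_eq_sum [Fintype V] (D : Submodule k V) (x : V)
    (F₀ : V →ₛₗ[σ] V) (F₁ : V → V →ₛₗ[σ] V)
    (hF₁ : ∀ y, (∀ v ∈ D, F₁ y v = F₀ v) ∧ F₁ y x = y) :
    Nat.card (NilExtension D F₀) =
      ∑ y, Nat.card (NilExtension (D ⊔ Submodule.span k {x}) (F₁ y)) := by
  have := finite_semilinear (σ := σ) (V := V)
  rw [← Nat.card_congr (Equiv.sigmaFiberEquiv fun F : NilExtension D F₀ ↦ F.1 x), Nat.card_sigma]
  refine Finset.sum_congr rfl fun y _ ↦ Nat.card_congr ?_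
  refine (Equiv.subtypeSubtypeEquivSubtypeInter _ fun F : V →ₛₗ[σ] V ↦ F x = y).trans
    (Equiv.subtypeEquivRight fun F ↦ ?_)
  rw [and_assoc]
  refine and_congr_right fun _ ↦ ⟨fun ⟨hD, hx⟩ v hv ↦ ?_, fun h ↦ ⟨fun v hv ↦ ?_, ?_⟩⟩
  · obtain ⟨d, hd, z, hz, rfl⟩ := Submodule.mem_sup.1 hv
    obtain ⟨c, rfl⟩ := Submodule.mem_span_singleton.1 hz
    simp [hD d hd, (hF₁ y).1 d hd, (hF₁ y).2, hx]
  · rw [h v (le_sup_left (a := D) hv), (hF₁ y).1 v hv]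
  · rw [h x (le_sup_right (a := D) (Submodule.mem_span_singleton_self x)), (hF₁ y).2]

theorem le_nilSubspace_congr {F G : V →ₛₗ[σ] V} {W : Submodule k V} (hW : W ≤ W.comap F)
    (hFG : ∀ v ∈ W, G v = F v) (h : W ≤ nilSubspace F) : W ≤ nilSubspace G := by
  intro v hv
  obtain ⟨n, hn⟩ := h hv
  refine ⟨n, ?_⟩
  suffices ∀ i, G^[i] v = F^[i] v by rw [this, hn]
  intro i
  induction i with
  | zero => rfl
  | succ i ih =>
    rw [Function.iterate_succ_apply', Function.iterate_succ_apply', ih,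
      hFG _ (iterate_mem_of_le hW (Nat.zero_le i) hv)]

/-- If a nilpotent map acts as a shift on `u 0, …, u m` and sends `u m` into
`chainSpan W u (m + 1)`, it sends `u m` into `W`. -/
theorem apply_mem_of_chain {F : V →ₛₗ[σ] V} {W : Submodule k V} (hW : W ≤ W.comap F)
    (hF : nilSubspace F = ⊤) {u : ℕ → V} {m : ℕ} (hu : ∀ i < m, F (u i) = u (i + 1))
    (hm : F (u m) ∈ chainSpan W u (m + 1)) : F (u m) ∈ W := by
  have hit : ∀ i ≤ m, F^[i] (u 0) = u i := by
    intro i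
    induction i with
    | zero => intro _; rfl
    | succ i ih =>
      intro hi
      rw [Function.iterate_succ_apply', ih (by omega), hu i (by omega)]
  have hm1 : F^[m + 1] (u 0) = F (u m) := by
    rw [Function.iterate_succ_apply', hit m le_rfl]
  rw [← hm1] at hm ⊢
  refine iterate_mem_of_mem_chainSpan hW ?_ ?_
  · obtain ⟨n, hn⟩ : u 0 ∈ nilSubspace F := hF ▸ Submodule.mem_top
    exact ⟨n, hn ▸ zero_mem W⟩
  · rwa [chainSpan_congr W (u' := u) fun i hi ↦ hit i (by omega)]

/-- A shift along a chain ending in `W` preserves the span of the chain and is nilpotent there. -/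
theorem chainSpan_invariant {F : V →ₛₗ[σ] V} {W : Submodule k V} (hW : W ≤ W.comap F)
    (hN : W ≤ nilSubspace F) {u : ℕ → V} {m : ℕ} (hu : ∀ i < m, F (u i) = u (i + 1))
    (hm : F (u m) ∈ W) :
    chainSpan W u (m + 1) ≤ (chainSpan W u (m + 1)).comap F ∧
      chainSpan W u (m + 1) ≤ nilSubspace F := by
  constructor
  · refine chainSpan_le (hW.trans (Submodule.comap_mono (le_chainSpan ..))) fun i hi ↦ ?_
    rw [Submodule.mem_comap]
    rcases (Nat.lt_succ_iff_lt_or_eq.1 hi) with h | rfl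
    · rw [hu i h]; exact mem_chainSpan W u (by omega)
    · exact le_chainSpan _ _ _ hm
  · have hdesc : ∀ j ≤ m, u (m - j) ∈ nilSubspace F := by
      intro j
      induction j with
      | zero => intro _; exact mem_nilSubspace_of_apply (hN hm)
      | succ j ih =>
        intro hj
        refine mem_nilSubspace_of_apply ?_
        rw [hu _ (by omega), show m - (j + 1) + 1 = m - j by omega]
        exact ih (by omega)
    refine chainSpan_le hN fun i hi ↦ ?_
    have := hdesc (m - i) (by omega)
    rwa [show m - (m - i) = i by omega] at this

variable (k V σ) in
/-- The number of nilpotent extensions of a nilpotent map from an invariant subspace of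
codimension `n`. -/
def CardNilExtensionInvariant (n : ℕ) : Prop :=
  ∀ (W : Submodule k V) (F₀ : V →ₛₗ[σ] V), W ≤ W.comap F₀ → W ≤ nilSubspace F₀ →
    finrank k W + n = finrank k V →
    Nat.card (NilExtension W F₀) = Nat.card k ^ (n * (finrank k V - 1))

variable (k V σ) in
/-- The number of nilpotent extensions of a map from the sum, of codimension `n + 1`, of an
invariant subspace on which it is nilpotent and the start of an independent chain. -/
def CardNilExtensionChain (n : ℕ) : Prop :=
  ∀ (W : Submodule k V) (F₀ : V →ₛₗ[σ] V) (u : ℕ → V) (m : ℕ),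
    W ≤ W.comap F₀ → W ≤ nilSubspace F₀ → (∀ i < m, F₀ (u i) = u (i + 1)) →
    u m ∉ chainSpan W u m → finrank k (chainSpan W u m) + (n + 1) = finrank k V →
    Nat.card (NilExtension (chainSpan W u m) F₀) =
      Nat.card k ^ (finrank k W + finrank k V * n)

theorem cardNilExtensionInvariant_succ {n : ℕ} (h : CardNilExtensionChain k V σ n) :
    CardNilExtensionInvariant k V σ (n + 1) := by
  intro W F₀ hW hN hdim
  obtain ⟨x, hx⟩ : ∃ x, x ∉ W := by
    by_contra! hall
    have : W = ⊤ := by ext; simp [hall]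
    rw [this, finrank_top] at hdim
    omega
  have := h W F₀ (fun _ ↦ x) 0 hW hN (by simp) (by rwa [chainSpan_zero])
    (by rwa [chainSpan_zero])
  rw [chainSpan_zero] at this
  rw [this]
  congr 1
  rw [← hdim, show finrank k W + (n + 1) - 1 = finrank k W + n by omega]
  ring

theorem cardNilExtensionInvariant_zero [FiniteDimensional k V] :
    CardNilExtensionInvariant k V σ 0 := by
  intro W F₀ hW hN hdim
  obtain rfl : W = ⊤ := Submodule.eq_top_of_finrank_eq hdim
  rw [card_nilExtension_top (top_le_iff.1 hN), zero_mul, pow_zero]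

theorem cardNilExtensionChain_of_invariant [Finite k] [FiniteDimensional k V] {n : ℕ}
    (hI : CardNilExtensionInvariant k V σ n)
    (hC : ∀ p, n = p + 1 → CardNilExtensionChain k V σ p) :
    CardNilExtensionChain k V σ n := by
  classical
  intro W F₀ u m hW hN hu hum hdim
  have : Finite V := Module.finite_of_finite k
  have := Fintype.ofFinite V
  choose F₁ hF₁ using exists_semilinear_eqOn_apply_eq F₀ hum
  rw [card_nilExtension_eq_sum _ (u m) F₀ F₁ hF₁, ← chainSpan_succ]
  set g := finrank k V with hg
  set q := Nat.card k with hq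
  set D := chainSpan W u (m + 1) with hD
  have hdimD : finrank k D + n = g := by
    rw [hD, chainSpan_succ, Submodule.finrank_sup_span_singleton hum]; omega
  have hWD : W ≤ D := le_chainSpan ..
  have hF₁W : ∀ y, ∀ v ∈ W, F₁ y v = F₀ v := fun y v hv ↦
    (hF₁ y).1 v (le_chainSpan _ _ _ hv)
  have hW₁ : ∀ y, W ≤ W.comap (F₁ y) := fun y v hv ↦ by
    rw [Submodule.mem_comap, hF₁W y v hv]; exact hW hv
  have hN₁ : ∀ y, W ≤ nilSubspace (F₁ y) := fun y ↦ le_nilSubspace_congr hW (hF₁W y) hN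
  have hu₁ : ∀ y, ∀ i < m, F₁ y (u i) = u (i + 1) := fun y i hi ↦ by
    rw [(hF₁ y).1 _ (mem_chainSpan W u hi), hu i hi]
  have hin : ∀ y ∈ W, Nat.card (NilExtension D (F₁ y)) = q ^ (n * (g - 1)) := fun y hy ↦ by
    have := chainSpan_invariant (hW₁ y) (hN₁ y) (hu₁ y) (by rwa [(hF₁ y).2])
    exact hI D (F₁ y) this.1 this.2 hdimD
  have hmid : ∀ y ∈ D, y ∉ W → Nat.card (NilExtension D (F₁ y)) = 0 := fun y hy hyW ↦ by
    have : IsEmpty (NilExtension D (F₁ y)) := by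
      refine ⟨fun ⟨F, hF, hFD⟩ ↦ hyW ?_⟩
      have hFm : F (u m) = y := by
        rw [hFD _ (mem_chainSpan W u (Nat.lt_succ_self m)), (hF₁ y).2]
      rw [← hFm]
      refine apply_mem_of_chain (fun v hv ↦ ?_) hF (fun i hi ↦ ?_) (by rwa [hFm])
      · rw [Submodule.mem_comap, hFD v (hWD hv)]; exact hW₁ y hv
      · rw [hFD _ (mem_chainSpan W u (by omega)), hu₁ y i hi]
    exact Nat.card_of_isEmpty
  have hcardV : Fintype.card V = q ^ g := by
    rw [← Nat.card_eq_fintype_card, Module.natCard_eq_pow_finrank (K := k)]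
  have hcard : ∀ P : Submodule k V, (Finset.univ.filter (· ∈ P)).card = q ^ finrank k P := by
    intro P
    rw [← Fintype.card_subtype, ← Nat.card_eq_fintype_card]
    exact Module.natCard_eq_pow_finrank (K := k) (V := P)
  rcases n with _ | p
  · have hDtop : D = ⊤ := Submodule.eq_top_of_finrank_eq hdimD
    have hterm : ∀ y, Nat.card (NilExtension D (F₁ y)) = if y ∈ W then 1 else 0 := by
      intro y
      split_ifs with hy
      · rw [hin y hy, zero_mul, pow_zero]
      · exact hmid y (hDtop ▸ Submodule.mem_top) hy
    rw [Finset.sum_congr rfl fun y _ ↦ hterm y, Finset.sum_boole, hcard]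
    simp
  · have hout : ∀ y ∉ D, Nat.card (NilExtension D (F₁ y)) = q ^ (finrank k W + g * p) := by
      intro y hy
      have hcs : chainSpan W (Function.update u (m + 1) y) (m + 1) = D :=
        chainSpan_congr W fun i hi ↦ Function.update_of_ne (by omega) _ _
      have := hC p rfl W (F₁ y) (Function.update u (m + 1) y) (m + 1) (hW₁ y) (hN₁ y)
        (fun i hi ↦ ?_) (by rwa [hcs, Function.update_self]) (by rwa [hcs])
      · rwa [hcs] at this
      · rw [Function.update_of_ne (by omega)]
        rcases Nat.lt_succ_iff_lt_or_eq.1 hi with h | rfl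
        · rw [Function.update_of_ne (by omega), hu₁ y i h]
        · rw [Function.update_self, (hF₁ y).2]
    have hterm : ∀ y, Nat.card (NilExtension D (F₁ y)) +
        (if y ∈ D then q ^ (finrank k W + g * p) else 0) =
        (if y ∈ W then q ^ ((p + 1) * (g - 1)) else 0) + q ^ (finrank k W + g * p) := by
      intro y
      by_cases hy : y ∈ D
      · by_cases hyW : y ∈ W
        · simp [hy, hyW, hin y hyW]
        · simp [hy, hyW, hmid y hy hyW]
      · have hyW : y ∉ W := fun h ↦ hy (hWD h)
        simp [hy, hyW, hout y hy]
    have hsum := Finset.sum_congr (rfl : (Finset.univ : Finset V) = _) fun y _ ↦ hterm y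
    rw [Finset.sum_add_distrib, Finset.sum_add_distrib, ← Finset.sum_filter, ← Finset.sum_filter,
      Finset.sum_const, Finset.sum_const, Finset.sum_const, hcard, hcard, Finset.card_univ,
      hcardV] at hsum
    simp only [smul_eq_mul, ← pow_add] at hsum
    have he₁ : finrank k D + (finrank k W + g * p) = finrank k W + (p + 1) * (g - 1) := by
      obtain ⟨r, hr⟩ : ∃ r, g = r + 1 := ⟨g - 1, by omega⟩
      rw [hr, Nat.add_sub_cancel]
      have : finrank k D + p = r := by omega
      subst this
      ring
    have he₂ : g + (finrank k W + g * p) = finrank k W + g * (p + 1) := by ring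
    rw [he₁, he₂, add_comm] at hsum
    exact Nat.add_left_cancel hsum

theorem cardNilExtension_invariant_and_chain [Finite k] [FiniteDimensional k V] (n : ℕ) :
    CardNilExtensionInvariant k V σ n ∧ CardNilExtensionChain k V σ n := by
  induction n with
  | zero =>
    exact ⟨cardNilExtensionInvariant_zero,
      cardNilExtensionChain_of_invariant cardNilExtensionInvariant_zero (by omega)⟩
  | succ n ih =>
    have hI := cardNilExtensionInvariant_succ ih.2
    exact ⟨hI, cardNilExtensionChain_of_invariant hI fun p hp ↦ by
      obtain rfl : n = p := by omega
      exact ih.2⟩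

theorem card_nilSubspace_eq_top [Finite k] [FiniteDimensional k V] :
    Nat.card {F : V →ₛₗ[σ] V // nilSubspace F = ⊤} =
      Nat.card k ^ (finrank k V * (finrank k V - 1)) := by
  rw [← (cardNilExtension_invariant_and_chain (σ := σ) (finrank k V)).1 ⊥ 0 bot_le bot_le
    (by rw [finrank_bot, zero_add])]
  exact Nat.card_congr (Equiv.subtypeEquivRight fun F ↦ by simp)

end SemilinearNilpotent

/-- The number of nilpotent τ-semilinear endomorphisms (those with F^g = 0) of a
g-dimensional space over a field of order q equals q^(g² - g). -/
theorem count_nilpotent_semilinear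
    {k V : Type*} [Field k] [Fintype k] [AddCommGroup V] [Module k V]
    [FiniteDimensional k V]
    (q g : ℕ) (hq : Fintype.card k = q) (hg : Module.finrank k V = g)
    (hg1 : 1 ≤ g) (τ : k ≃+* k) :
    Nat.card {F : V →+ V // (∀ (a : k) (v : V), F (a • v) = τ a • F v) ∧
        ∀ v : V, (⇑F)^[g] v = 0} =
      q ^ (g ^ 2 - g) := by
  subst hq hg
  rw [← Nat.card_eq_fintype_card, sq, ← Nat.mul_sub_one,
    ← card_nilSubspace_eq_top (σ := (τ : k →+* k))]
  refine Nat.card_congr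
    { toFun := fun F ↦ ⟨{ toFun := F.1, map_add' := F.1.map_add, map_smul' := F.2.1 },
        eq_top_iff.2 fun v _ ↦ ⟨_, F.2.2 v⟩⟩
      invFun := fun F ↦ ⟨F.1.toAddMonoidHom, fun a v ↦ F.1.map_smulₛₗ a v,
        fun v ↦ iterate_finrank_eq_zero (eq_top_iff.1 F.2 trivial)⟩
      left_inv := fun F ↦ rfl
      right_inv := fun F ↦ rfl }
end
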